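/- arXiv:1911.01790 — 3 statements merged into one kernel-verified Lean document; each statement's English description precedes it below -/
import Mathlib

section
/- Let p > 3 be a prime. Then 2^{(9p-9)/2} * sum_{k=0}^{(p-3)/2} C((p-1)/2, 2k) * C(2k,k) * (H_k^2 + H_k^{(2)}) / 4^k ≡ 36*(-1)^{(p-1)/2} * q_p(2)^2 (mod p), where the congruence is between rational numbers whose denominators are coprime to p. -/
/-- `H2 n = ∑_{0 < k ≤ n} 1/k²`, the generalized harmonic number of order 2. -/
def H2 (n : ℕ) : ℚ := ∑ i ∈ Finset.range n, 1 / ((i : ℚ) + 1) ^ 2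

open Finset

/-- The summand `C(n, 2k) C(2k, k) / 4^k`. -/
def chooseWeight (n k : ℕ) : ℚ := (n.choose (2 * k) : ℚ) * ((2 * k).choose k : ℚ) / 4 ^ k

lemma cast_choose_succ_mul (n k : ℕ) :
    (n.choose (k + 1) : ℚ) * (k + 1) = n.choose k * ((n : ℚ) - k) := by
  rcases le_or_gt k n with h | h
  · have := Nat.choose_succ_right_eq n k
    rw [← Nat.cast_sub h]
    exact_mod_cast this
  · simp [Nat.choose_eq_zero_of_lt h, Nat.choose_eq_zero_of_lt (Nat.lt_succ_of_lt h)]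

lemma succ_mul_choose_two_mul_succ (k : ℕ) :
    ((k : ℚ) + 1) * ((2 * (k + 1)).choose (k + 1) : ℚ)
      = 2 * (2 * k + 1) * ((2 * k).choose k : ℚ) := by
  have := Nat.succ_mul_centralBinom_succ k
  simp only [Nat.centralBinom] at this
  exact_mod_cast this

lemma sum_chooseWeight_telescope {w v : ℕ → ℚ}
    (hw : ∀ k : ℕ, ((k : ℚ) + 1) * w (k + 1) - v (k + 1) = (k + 1) * w k) (n N : ℕ) :
    ∑ k ∈ range (N + 1), (((n : ℚ) + 1) * (chooseWeight (n + 1) k * w k)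
        - 2 * (chooseWeight (n + 1) k * v k) - (2 * n + 1) * (chooseWeight n k * w k)
        + 2 * (chooseWeight n k * v k))
      = -((n : ℚ) - 2 * N) * (chooseWeight n N * w N) := by
  induction N with
  | zero => simp [chooseWeight]; ring
  | succ N ih =>
    rw [sum_range_succ, ih]
    have h1 := cast_choose_succ_mul n (2 * N)
    have h2 := cast_choose_succ_mul n (2 * N + 1)
    have h3 := succ_mul_choose_two_mul_succ N
    have h4 := hw N
    have h5 : ((n + 1).choose (2 * (N + 1)) : ℚ)
        = n.choose (2 * N + 1) + n.choose (2 * (N + 1)) := by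
      rw [show 2 * (N + 1) = (2 * N + 1) + 1 by ring, Nat.choose_succ_succ]
      push_cast; rfl
    rw [show 2 * N + 1 + 1 = 2 * (N + 1) by ring] at h2
    unfold chooseWeight
    rw [h5]
    push_cast at h1 h2 ⊢
    generalize (n.choose (2 * (N + 1)) : ℚ) = B at *
    generalize (n.choose (2 * N + 1) : ℚ) = A at *
    generalize (n.choose (2 * N) : ℚ) = D at *
    generalize ((2 * (N + 1)).choose (N + 1) : ℚ) = c at *
    generalize ((2 * N).choose N : ℚ) = d at *
    rw [pow_succ]
    have h4N : (4 : ℚ) ^ N ≠ 0 := by positivity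
    field_simp
    linear_combination (4 * d * w N) * h1 - c * w (N + 1) * h2 + 2 * A * w N * h3
      + 2 * A * c * h4

lemma sum_chooseWeight_recurrence {w v : ℕ → ℚ}
    (hw : ∀ k : ℕ, ((k : ℚ) + 1) * w (k + 1) - v (k + 1) = (k + 1) * w k) {n N : ℕ}
    (hN : n + 2 ≤ 2 * N) :
    ((n : ℚ) + 1) * ∑ k ∈ range N, chooseWeight (n + 1) k * w k
        - 2 * ∑ k ∈ range N, chooseWeight (n + 1) k * v k
      = (2 * n + 1) * ∑ k ∈ range N, chooseWeight n k * w k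
        - 2 * ∑ k ∈ range N, chooseWeight n k * v k := by
  obtain ⟨N, rfl⟩ : ∃ M, N = M + 1 := ⟨N - 1, by omega⟩
  have h := sum_chooseWeight_telescope hw n N
  simp only [sum_add_distrib, sum_sub_distrib, ← mul_sum] at h
  have h0 : ((n : ℚ) - 2 * N) * chooseWeight n N = 0 := by
    rcases (show n ≤ 2 * N by omega).eq_or_lt with h | h
    · rw [h]; push_cast; ring
    · simp [chooseWeight, Nat.choose_eq_zero_of_lt h]
  linear_combination h - w N * h0

lemma sum_chooseWeight_zero (w : ℕ → ℚ) {N : ℕ} (hN : 0 < N) :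
    ∑ k ∈ range N, chooseWeight 0 k * w k = w 0 := by
  rw [sum_eq_single 0]
  · simp [chooseWeight]
  · intro k _ hk
    simp [chooseWeight, Nat.choose_eq_zero_of_lt (show 0 < 2 * k by omega)]
  · simp; omega

/-- The product `∏_{i < n} (2i+1)/(i+1)`, which is `C(2n, n) / 2^n`. -/
def oddRatio (n : ℕ) : ℚ := ∏ i ∈ range n, (2 * (i : ℚ) + 1) / (i + 1)

/-- Sum of the reciprocals of the first `n` odd numbers, raised to the power `r`. -/
def oddHarmonic (r n : ℕ) : ℚ := ∑ i ∈ range n, 1 / (2 * (i : ℚ) + 1) ^ r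

lemma sum_chooseWeight {n N : ℕ} (h : n + 1 ≤ 2 * N) :
    ∑ k ∈ range N, chooseWeight n k * 1 = oddRatio n := by
  induction n with
  | zero => rw [sum_chooseWeight_zero (fun _ => 1) (by omega)]; simp [oddRatio]
  | succ n ih =>
    have := sum_chooseWeight_recurrence (w := fun _ => 1) (v := fun _ => 0) (by intro k; ring) h
    rw [ih (by omega)] at this
    rw [oddRatio, prod_range_succ, ← oddRatio]
    simp only [mul_zero, sum_const_zero] at this
    generalize ∑ k ∈ range N, chooseWeight (n + 1) k * 1 = S at *
    field_simp
    linear_combination this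

lemma sum_chooseWeight_mul_harmonic {n N : ℕ} (h : n + 1 ≤ 2 * N) :
    ∑ k ∈ range N, chooseWeight n k * harmonic k
      = oddRatio n * (2 * (harmonic n - oddHarmonic 1 n)) := by
  induction n with
  | zero => rw [sum_chooseWeight_zero harmonic (by omega)]; simp [oddHarmonic]
  | succ n ih =>
    have := sum_chooseWeight_recurrence (w := harmonic) (v := fun _ => 1)
      (by intro k; rw [harmonic_succ]; push_cast; field_simp; ring) h
    rw [ih (by omega), sum_chooseWeight h, sum_chooseWeight (show n + 1 ≤ 2 * N by omega)] at this
    rw [oddRatio, prod_range_succ, ← oddRatio] at this ⊢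
    rw [oddHarmonic, sum_range_succ, ← oddHarmonic, harmonic_succ]
    have h1 : (n : ℚ) + 1 ≠ 0 := by positivity
    have h2 : 2 * (n : ℚ) + 1 ≠ 0 := by positivity
    apply mul_left_cancel₀ h1
    push_cast
    field_simp at this ⊢
    linear_combination this

lemma sum_chooseWeight_mul_harmonic_sq {n N : ℕ} (h : n + 1 ≤ 2 * N) :
    ∑ k ∈ range N, chooseWeight n k * ((harmonic k ^ 2 + H2 k) / 2)
      = oddRatio n * (2 * (harmonic n - oddHarmonic 1 n) ^ 2 + 2 * (H2 n - oddHarmonic 2 n)) := by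
  induction n with
  | zero =>
    rw [sum_chooseWeight_zero (fun k => (harmonic k ^ 2 + H2 k) / 2) (by omega)]
    simp [oddHarmonic, H2]
  | succ n ih =>
    have := sum_chooseWeight_recurrence (w := fun k => (harmonic k ^ 2 + H2 k) / 2) (v := harmonic)
      (by intro k; rw [H2, sum_range_succ, ← H2, harmonic_succ]; push_cast; field_simp; ring) h
    rw [ih (by omega), sum_chooseWeight_mul_harmonic h,
      sum_chooseWeight_mul_harmonic (show n + 1 ≤ 2 * N by omega)] at this
    rw [oddRatio, prod_range_succ, ← oddRatio] at this ⊢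
    simp only [oddHarmonic, H2, sum_range_succ, harmonic_succ] at this ⊢
    simp only [← oddHarmonic.eq_def, ← H2.eq_def] at this ⊢
    have h1 : (n : ℚ) + 1 ≠ 0 := by positivity
    have h2 : 2 * (n : ℚ) + 1 ≠ 0 := by positivity
    apply mul_left_cancel₀ h1
    push_cast at this ⊢
    rw [sub_eq_iff_eq_add.mp this]
    field_simp
    ring

/-- `ReducesTo p r c`: the rational `r` is `p`-integral and its residue class mod `p` is `c`. -/
def ReducesTo (p : ℕ) [Fact p.Prime] (r : ℚ) (c : ZMod p) : Prop :=
  ∃ a b : ℤ, (b : ZMod p) ≠ 0 ∧ r = a / b ∧ c = a / b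

namespace ReducesTo

variable {p : ℕ} [Fact p.Prime] {r s : ℚ} {c d : ZMod p}

lemma cast_ne_zero {b : ℤ} (hb : (b : ZMod p) ≠ 0) : (b : ℚ) ≠ 0 := by
  rintro h
  apply hb
  rw [Int.cast_eq_zero.mp h, Int.cast_zero]

lemma intCast (a : ℤ) : ReducesTo p a a := ⟨a, 1, by simp, by simp, by simp⟩

lemma natCast (a : ℕ) : ReducesTo p a a := by simpa using intCast (p := p) a

lemma one_div_natCast {b : ℕ} (hb : (b : ZMod p) ≠ 0) : ReducesTo p (1 / b) (1 / b) :=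
  ⟨1, b, by simpa using hb, by simp, by simp⟩

lemma add (hr : ReducesTo p r c) (hs : ReducesTo p s d) : ReducesTo p (r + s) (c + d) := by
  obtain ⟨a, b, hb, rfl, rfl⟩ := hr
  obtain ⟨a', b', hb', rfl, rfl⟩ := hs
  refine ⟨a * b' + b * a', b * b', by simp [hb, hb'], ?_, ?_⟩
  · push_cast; exact div_add_div _ _ (cast_ne_zero hb) (cast_ne_zero hb')
  · push_cast; exact div_add_div _ _ hb hb'

lemma mul (hr : ReducesTo p r c) (hs : ReducesTo p s d) : ReducesTo p (r * s) (c * d) := by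
  obtain ⟨a, b, hb, rfl, rfl⟩ := hr
  obtain ⟨a', b', hb', rfl, rfl⟩ := hs
  refine ⟨a * a', b * b', by simp [hb, hb'], ?_, ?_⟩ <;> push_cast <;> rw [div_mul_div_comm]

lemma sub (hr : ReducesTo p r c) (hs : ReducesTo p s d) : ReducesTo p (r - s) (c - d) := by
  have := hr.add ((intCast (-1)).mul hs)
  push_cast at this
  convert this using 1 <;> ring

lemma pow (hr : ReducesTo p r c) (k : ℕ) : ReducesTo p (r ^ k) (c ^ k) := by
  induction k with
  | zero => simpa using natCast (p := p) 1
  | succ k ih => simpa only [pow_succ] using ih.mul hr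

lemma sum {ι : Type*} {t : Finset ι} {f : ι → ℚ} {g : ι → ZMod p}
    (h : ∀ i ∈ t, ReducesTo p (f i) (g i)) : ReducesTo p (∑ i ∈ t, f i) (∑ i ∈ t, g i) := by
  induction t using Finset.cons_induction with
  | empty => simpa using natCast (p := p) 0
  | cons a t ha ih =>
    rw [sum_cons, sum_cons]
    exact (h a (by simp)).add (ih fun i hi => h i (by simp [hi]))

lemma prod {ι : Type*} {t : Finset ι} {f : ι → ℚ} {g : ι → ZMod p}
    (h : ∀ i ∈ t, ReducesTo p (f i) (g i)) : ReducesTo p (∏ i ∈ t, f i) (∏ i ∈ t, g i) := by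
  induction t using Finset.cons_induction with
  | empty => simpa using natCast (p := p) 1
  | cons a t ha ih =>
    rw [prod_cons, prod_cons]
    exact (h a (by simp)).mul (ih fun i hi => h i (by simp [hi]))

lemma dvd_num (h : ReducesTo p r 0) : (p : ℤ) ∣ r.num := by
  obtain ⟨a, b, hb, rfl, hc⟩ := h
  have ha : (a : ZMod p) = 0 := by
    rcases div_eq_zero_iff.mp hc.symm with h | h
    · exact h
    · exact absurd h hb
  rw [ZMod.intCast_zmod_eq_zero_iff_dvd] at ha
  rw [Ne, ZMod.intCast_zmod_eq_zero_iff_dvd] at hb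
  have h1 : ((a / b : ℚ)).num * b = a * ((a / b : ℚ)).den := by
    have h2 := Rat.num_div_den (a / b : ℚ)
    have h3 := cast_ne_zero (p := p) (b := b) (by rwa [Ne, ZMod.intCast_zmod_eq_zero_iff_dvd])
    have h4 : (((a / b : ℚ)).den : ℚ) ≠ 0 := by positivity
    rw [div_eq_div_iff h4 h3] at h2
    exact_mod_cast h2
  have hp : Prime (p : ℤ) := Nat.prime_iff_prime_int.mp Fact.out
  exact (hp.dvd_or_dvd (h1 ▸ ha.mul_right _)).resolve_right hb

end ReducesTo

section ZModSums

variable {p : ℕ} [Fact p.Prime]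

lemma natCast_zmod_ne_zero {k : ℕ} (hk : 0 < k) (hkp : k < p) : (k : ZMod p) ≠ 0 := by
  rw [Ne, ZMod.natCast_eq_zero_iff]
  exact Nat.not_dvd_of_pos_of_lt hk hkp

lemma sum_range_two_mul {M : Type*} [AddCommMonoid M] (f : ℕ → M) (n : ℕ) :
    ∑ k ∈ range (2 * n), f k = ∑ i ∈ range n, f (2 * i) + ∑ i ∈ range n, f (2 * i + 1) := by
  rw [← sum_add_distrib]
  induction n with
  | zero => simp
  | succ n ih =>
    rw [show 2 * (n + 1) = 2 * n + 1 + 1 by ring, sum_range_succ, sum_range_succ, sum_range_succ,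
      ih, add_assoc]

lemma sum_range_natCast_zmod {M : Type*} [AddCommMonoid M] (f : ZMod p → M) :
    ∑ k ∈ range p, f k = ∑ x, f x := by
  refine sum_nbij' (fun k => (k : ZMod p)) ZMod.val ?_ ?_ ?_ ?_ ?_
  · simp
  · intro x _; simpa using ZMod.val_lt x
  · intro k hk; exact ZMod.val_cast_of_lt (by simpa using hk)
  · intro x _; simp
  · simp

lemma sum_range_one_div_pow {r : ℕ} (hr : 0 < r) (hrp : r < p - 1) :
    ∑ k ∈ range (p - 1), 1 / ((k : ZMod p) + 1) ^ r = 0 := by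
  have hp : p.Prime := Fact.out
  have h := sum_range_natCast_zmod (p := p) fun x => 1 / x ^ r
  have hsucc : range p = range (p - 1 + 1) := by rw [Nat.sub_add_cancel hp.one_le]
  rw [hsucc, sum_range_succ'] at h
  simp only [Nat.cast_add, Nat.cast_one, Nat.cast_zero, zero_pow hr.ne', div_zero, add_zero] at h
  rw [h, ← FiniteField.sum_pow_lt_card_sub_one (ZMod p) r (by rwa [ZMod.card])]
  rw [← Equiv.sum_comp (Equiv.inv (ZMod p)) fun x => x ^ r]
  simp

lemma choose_pred_zmod {k : ℕ} (hk : k < p) : ((p - 1).choose k : ZMod p) = (-1) ^ k := by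
  have hp : p.Prime := Fact.out
  induction k with
  | zero => simp
  | succ k ih =>
    have h : p.choose (k + 1) = (p - 1).choose k + (p - 1).choose (k + 1) := by
      rw [← Nat.choose_succ_succ, Nat.succ_eq_add_one, Nat.sub_add_cancel hp.one_le]
    have h0 : (p.choose (k + 1) : ZMod p) = 0 := by
      rw [ZMod.natCast_eq_zero_iff]
      exact hp.dvd_choose_self (by omega) hk
    rw [h, Nat.cast_add, ih (by omega)] at h0
    rw [pow_succ]
    linear_combination h0

end ZModSums

lemma two_mul_fermatQuotient_two {p : ℕ} (hp : p ≠ 0) :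
    2 * ((2 ^ (p - 1) - 1) / (p : ℚ)) =
      (∑ k ∈ range (p - 1), ((p - 1).choose k : ℚ) * (1 / ((k + 1 : ℕ) : ℚ))) := by
  obtain ⟨m, rfl⟩ := Nat.exists_eq_succ_of_ne_zero hp
  have h := Nat.sum_range_choose (m + 1)
  rw [sum_range_succ, sum_range_succ'] at h
  have h' : (∑ k ∈ range m, ((m + 1).choose (k + 1) : ℚ)) + 1 + 1 = 2 ^ (m + 1) := by
    simpa using congrArg (Nat.cast : ℕ → ℚ) h
  have hm : (m : ℚ) + 1 ≠ 0 := by positivity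
  have hs : ∑ k ∈ range m, (m.choose k : ℚ) * (1 / ((k + 1 : ℕ) : ℚ))
      = (∑ k ∈ range m, ((m + 1).choose (k + 1) : ℚ)) / (m + 1) := by
    rw [sum_div]
    refine sum_congr rfl fun k _ => ?_
    have hk : (((m + 1) * m.choose k : ℕ) : ℚ) = ((m + 1).choose (k + 1) * (k + 1) : ℕ) := by
      exact_mod_cast Nat.add_one_mul_choose_eq m k
    push_cast at hk ⊢
    field_simp
    linear_combination hk
  simp only [Nat.succ_eq_add_one, Nat.add_sub_cancel]
  rw [hs]
  push_cast
  field_simp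
  rw [pow_succ] at h'
  linear_combination -h'

section HalfPrime

variable {p n : ℕ} [Fact p.Prime]

lemma natCast_two_mul_add_one_eq_zero (hn : p = 2 * n + 1) : 2 * (n : ZMod p) + 1 = 0 := by
  have : ((2 * n + 1 : ℕ) : ZMod p) = 0 := by rw [← hn]; simp
  exact_mod_cast this

lemma reducesTo_harmonic (hn : p = 2 * n + 1) :
    ReducesTo p (harmonic n) (∑ i ∈ range n, 1 / ((i : ZMod p) + 1)) := by
  refine ReducesTo.sum fun i hi => ?_
  have := ReducesTo.one_div_natCast (p := p)
    (natCast_zmod_ne_zero (k := i + 1) (by omega) (by simp at hi; omega))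
  simpa using this

lemma reducesTo_H2 (hn : p = 2 * n + 1) :
    ReducesTo p (H2 n) (∑ i ∈ range n, 1 / ((i : ZMod p) + 1) ^ 2) := by
  refine ReducesTo.sum fun i hi => ?_
  have := (ReducesTo.one_div_natCast (p := p)
    (natCast_zmod_ne_zero (k := i + 1) (by omega) (by simp at hi; omega))).pow 2
  simpa using this

lemma reducesTo_oddHarmonic (hn : p = 2 * n + 1) (r : ℕ) :
    ReducesTo p (oddHarmonic r n) (∑ i ∈ range n, 1 / (2 * (i : ZMod p) + 1) ^ r) := by
  refine ReducesTo.sum fun i hi => ?_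
  have := (ReducesTo.one_div_natCast (p := p)
    (natCast_zmod_ne_zero (k := 2 * i + 1) (by omega) (by simp at hi; omega))).pow r
  simpa using this

lemma reducesTo_oddRatio (hn : p = 2 * n + 1) : ReducesTo p (oddRatio n) ((-2) ^ n) := by
  have h : ReducesTo p (oddRatio n) (∏ i ∈ range n, (2 * (i : ZMod p) + 1) / (i + 1)) := by
    refine ReducesTo.prod fun i hi => ?_
    have := (ReducesTo.natCast (p := p) (2 * i + 1)).mul (ReducesTo.one_div_natCast (p := p)
      (natCast_zmod_ne_zero (k := i + 1) (by omega) (by simp at hi; omega)))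
    simpa [div_eq_mul_inv] using this
  convert h using 1
  have hne : ∏ i ∈ range n, ((i : ZMod p) + 1) ≠ 0 := by
    refine prod_ne_zero_iff.mpr fun i hi => ?_
    have := natCast_zmod_ne_zero (p := p) (k := i + 1) (by omega) (by simp at hi; omega)
    simpa using this
  rw [prod_div_distrib, eq_div_iff hne, ← prod_range_reflect (fun i => 2 * ((i : ℕ) : ZMod p) + 1)]
  have hc : ((-2 : ZMod p)) ^ n = ∏ _i ∈ range n, (-2 : ZMod p) := by simp
  rw [hc, ← prod_mul_distrib]
  refine prod_congr rfl fun i hi => ?_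
  have hi' : i + 1 ≤ n := by simpa using hi
  rw [show n - 1 - i = n - (i + 1) by omega, Nat.cast_sub hi']
  push_cast
  linear_combination -natCast_two_mul_add_one_eq_zero hn

lemma two_zmod_ne_zero (hn : p = 2 * n + 1) : (2 : ZMod p) ≠ 0 := by
  have hp : p.Prime := Fact.out
  have := natCast_zmod_ne_zero (p := p) (k := 2) (by omega) (by have := hp.two_le; omega)
  simpa using this

lemma sum_odd_add_sum_half (hn : p = 2 * n + 1) {r : ℕ} (hr : 0 < r) (hrp : r < p - 1) :
    ∑ i ∈ range n, 1 / (2 * (i : ZMod p) + 1) ^ r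
      + (∑ i ∈ range n, 1 / ((i : ZMod p) + 1) ^ r) / 2 ^ r = 0 := by
  have h := sum_range_one_div_pow (p := p) hr hrp
  rw [show p - 1 = 2 * n by omega, sum_range_two_mul] at h
  rw [← h, sum_div]
  congr 1
  · push_cast; rfl
  · refine sum_congr rfl fun i _ => ?_
    rw [div_div, ← mul_pow]
    push_cast
    ring_nf

lemma sum_half_one_div_sq (hn : p = 2 * n + 1) (hp3 : 3 < p) :
    ∑ i ∈ range n, 1 / ((i : ZMod p) + 1) ^ 2 = 0 := by
  have h := sum_range_one_div_pow (p := p) (r := 2) (by omega) (by omega)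
  rw [show p - 1 = n + n by omega, sum_range_add,
    ← sum_range_reflect (fun k => 1 / (((n + k : ℕ) : ZMod p) + 1) ^ 2)] at h
  have h' : ∑ k ∈ range n, 1 / (((n + (n - 1 - k) : ℕ) : ZMod p) + 1) ^ 2
      = ∑ k ∈ range n, 1 / ((k : ZMod p) + 1) ^ 2 := by
    refine sum_congr rfl fun k hk => ?_
    have hk' : k + 1 ≤ n := by simpa using hk
    rw [show n - 1 - k = n - (k + 1) by omega, Nat.cast_add, Nat.cast_sub hk']
    congr 1
    push_cast
    linear_combination (2 * (n : ZMod p) - 2 * k - 1) * natCast_two_mul_add_one_eq_zero hn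
  rw [h', ← two_mul] at h
  exact (mul_eq_zero.mp h).resolve_left (two_zmod_ne_zero hn)

lemma reducesTo_two_mul_fermatQuotient_two (hn : p = 2 * n + 1) :
    ReducesTo p (2 * ((2 ^ (p - 1) - 1) / (p : ℚ)))
      (∑ i ∈ range n, 1 / (2 * (i : ZMod p) + 1) - (∑ i ∈ range n, 1 / ((i : ZMod p) + 1)) / 2) := by
  rw [two_mul_fermatQuotient_two (by omega)]
  have h : ReducesTo p (∑ k ∈ range (p - 1), ((p - 1).choose k : ℚ) * (1 / ((k + 1 : ℕ) : ℚ)))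
      (∑ k ∈ range (p - 1), (-1) ^ k * (1 / ((k + 1 : ℕ) : ZMod p))) := by
    refine ReducesTo.sum fun k hk => ?_
    have hk' : k < p - 1 := by simpa using hk
    have h1 := ReducesTo.natCast (p := p) ((p - 1).choose k)
    rw [choose_pred_zmod (by omega)] at h1
    exact h1.mul (ReducesTo.one_div_natCast (natCast_zmod_ne_zero (by omega) (by omega)))
  convert h using 1
  rw [show p - 1 = 2 * n by omega, sum_range_two_mul, sub_eq_add_neg, sum_div, ← sum_neg_distrib]
  congr 1
  · refine sum_congr rfl fun i _ => ?_
    simp [pow_mul]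
  · refine sum_congr rfl fun i _ => ?_
    rw [pow_succ, pow_mul, neg_one_sq, one_pow, div_div]
    push_cast
    ring_nf

end HalfPrime

/-- Lemma 2.4 (Mao): for any prime `p > 3`,
`2^{(9p-9)/2} ∑_{k=0}^{(p-3)/2} C((p-1)/2,2k) C(2k,k) (H_k² + H_k⁽²⁾) / 4^k
  ≡ 36(-1)^{(p-1)/2} q_p(2)² (mod p)`, where `q_p(2) = (2^{p-1}-1)/p`. -/
theorem pow_mul_sum_choose_harmonic_sq_congr (p : ℕ) (hp : p.Prime) (hp3 : 3 < p) :
    ((p : ℤ)) ∣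
      (2 ^ ((9 * p - 9) / 2) *
          (∑ k ∈ Finset.range ((p - 3) / 2 + 1),
            (((p - 1) / 2).choose (2 * k) : ℚ) * ((2 * k).choose k : ℚ) *
              ((harmonic k) ^ 2 + H2 k) / 4 ^ k) -
        36 * (-1) ^ ((p - 1) / 2) * ((2 ^ (p - 1) - 1) / (p : ℚ)) ^ 2).num := by
  have : Fact p.Prime := ⟨hp⟩
  obtain ⟨n, hn⟩ : ∃ n, p = 2 * n + 1 := hp.odd_of_ne_two (by omega)
  rw [show (9 * p - 9) / 2 = 9 * n by omega, show (p - 3) / 2 + 1 = n by omega,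
    show (p - 1) / 2 = n by omega]
  have hsum : ∑ k ∈ range n, (n.choose (2 * k) : ℚ) * ((2 * k).choose k : ℚ) *
      ((harmonic k) ^ 2 + H2 k) / 4 ^ k
      = 2 * (oddRatio n *
        (2 * (harmonic n - oddHarmonic 1 n) ^ 2 + 2 * (H2 n - oddHarmonic 2 n))) := by
    rw [← sum_chooseWeight_mul_harmonic_sq (show n + 1 ≤ 2 * n by omega), mul_sum]
    refine sum_congr rfl fun k _ => ?_
    rw [chooseWeight]
    ring
  rw [hsum]
  have hq := reducesTo_two_mul_fermatQuotient_two hn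
  set q : ℚ := (2 ^ (p - 1) - 1) / (p : ℚ)
  have h1 := sum_odd_add_sum_half hn (r := 1) (by omega) (by omega)
  have h2 := sum_odd_add_sum_half hn (r := 2) (by omega) (by omega)
  have hH := reducesTo_harmonic hn
  have hHH := reducesTo_H2 hn
  have hO := reducesTo_oddHarmonic hn 1
  have hOO := reducesTo_oddHarmonic hn 2
  rw [sum_half_one_div_sq hn hp3] at h2 hHH
  rw [zero_div, add_zero] at h2
  rw [h2] at hOO
  simp only [pow_one] at h1 hO
  have hfermat : (2 : ZMod p) ^ (2 * n) = 1 := by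
    rw [show 2 * n = p - 1 by omega]
    exact ZMod.pow_card_sub_one_eq_one (two_zmod_ne_zero hn)
  set h := ∑ i ∈ range n, 1 / ((i : ZMod p) + 1)
  have ho : ∑ i ∈ range n, 1 / (2 * (i : ZMod p) + 1) = - (h / 2) := by linear_combination h1
  rw [ho] at hO hq
  have two := ReducesTo.natCast (p := p) 2
  have key := (((two.pow (9 * n)).mul (two.mul ((reducesTo_oddRatio hn).mul
    ((two.mul ((hH.sub hO).pow 2)).add (two.mul (hHH.sub hOO)))))).sub
    (((ReducesTo.intCast 9).mul ((ReducesTo.intCast (-1)).pow n)).mul (hq.pow 2)))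
  apply ReducesTo.dvd_num
  convert key using 1
  · push_cast
    ring
  · have hpow : (2 : ZMod p) ^ (9 * n) * (-2) ^ n = (-1) ^ n := by
      rw [show (-2 : ZMod p) = -1 * 2 by ring, mul_pow,
        show (2 : ZMod p) ^ (9 * n) * ((-1) ^ n * 2 ^ n) = (-1) ^ n * (2 ^ (2 * n)) ^ 5 by ring,
        hfermat, one_pow, mul_one]
    have hhalf : h / 2 * 2 = h := div_mul_cancel₀ _ (two_zmod_ne_zero hn)
    generalize h / 2 = t at *
    rw [← hhalf]
    push_cast
    linear_combination (-36 * t ^ 2) * hpow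
end

section
/- Let p > 3 be a prime. Then sum_{k=1}^{floor((p-1)/4)} C(4k,2k) * C(2k,k) * H_k^{(2)} / 64^k ≡ -E_{p-3}(1/4) (mod p), where the congruence is between rational numbers whose denominators are coprime to p. -/
/-- The `n`-th Euler polynomial evaluated at `x`, via the standard closed form
`E_n(x) = ∑_{k=0}^n 2^{-k} ∑_{j=0}^k (-1)^j C(k,j) (x+j)^n`,
which agrees with the generating function definition `2e^{xt}/(e^t+1) = ∑ E_n(x) tⁿ/n!`. -/
def eulerE (n : ℕ) (x : ℚ) : ℚ :=
  ∑ k ∈ Finset.range (n + 1), (1 / 2 ^ k) *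
    ∑ j ∈ Finset.range (k + 1), (-1) ^ j * (k.choose j) * (x + j) ^ n

open Finset

section Field

variable {K : Type*} [Field K]

/-- The Euler polynomial `E_n` evaluated at `x` in an arbitrary field. -/
def eulerField (n : ℕ) (x : K) : K :=
  ∑ k ∈ range (n + 1), (1 / 2 ^ k) *
    ∑ j ∈ range (k + 1), (-1) ^ j * (k.choose j) * (x + j) ^ n

lemma sum_neg_one_pow_choose_eq_fwdDiff_iter (f : K → K) (k : ℕ) (x : K) :
    ∑ j ∈ range (k + 1), (-1) ^ j * (k.choose j) * f (x + j) =
      (-1) ^ k * (fwdDiff 1)^[k] f x := by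
  rw [fwdDiff_iter_eq_sum_shift, mul_sum]
  refine sum_congr rfl fun j hj => ?_
  have hj' : j ≤ k := by simpa [Nat.lt_succ_iff] using hj
  obtain ⟨l, rfl⟩ := Nat.exists_eq_add_of_le hj'
  have h1 : ((-1 : K) ^ l) * (-1) ^ l = 1 := by rw [← mul_pow]; simp
  simp only [Nat.add_sub_cancel_left, zsmul_eq_mul, nsmul_eq_mul, mul_one]
  push_cast
  rw [pow_add]
  linear_combination (-(-1) ^ j * ((j + l).choose j : K) * f (x + j)) * h1

lemma eulerField_add_one_add (h2 : (2 : K) ≠ 0) (n : ℕ) (x : K) :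
    eulerField n (x + 1) + eulerField n x = 2 * x ^ n := by
  set D : ℕ → K → K := fun k x => (-1) ^ k * (fwdDiff 1)^[k] (fun r : K => r ^ n) x with hD
  have hE (y : K) : eulerField n y = ∑ k ∈ range (n + 1), (1 / 2 ^ k) * D k y := by
    refine sum_congr rfl fun k _ => ?_
    rw [sum_neg_one_pow_choose_eq_fwdDiff_iter (fun r : K => r ^ n)]
  have hstep (k : ℕ) : D k (x + 1) = D k x - D (k + 1) x := by
    simp only [hD, Function.iterate_succ_apply', fwdDiff]
    ring
  have htel (N : ℕ) : ∑ k ∈ range N, (1 / 2 ^ k) * (D k (x + 1) + D k x) =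
      2 * D 0 x - 2 / 2 ^ N * D N x := by
    induction N with
    | zero => simp
    | succ N ih =>
      rw [sum_range_succ, ih, hstep]
      field_simp
      ring
  rw [hE, hE, ← sum_add_distrib]
  simp_rw [← mul_add]
  rw [htel]
  simp [hD, fwdDiff_iter_pow_eq_zero_of_lt]

lemma eulerField_one_sub (p : ℕ) [CharP K p] (hp : Odd p) (h2 : (2 : K) ≠ 0)
    {n : ℕ} (hn : Even n) (x : K) : eulerField n (1 - x) = eulerField n x := by
  have hstep (y : K) : eulerField n (1 - (y + 1)) - eulerField n (y + 1) =
      -(eulerField n (1 - y) - eulerField n y) := by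
    have h3 := eulerField_add_one_add h2 n y
    have h4 := eulerField_add_one_add h2 n (-y)
    rw [hn.neg_pow, neg_add_eq_sub] at h4
    rw [show 1 - (y + 1) = -y by ring]
    linear_combination h4 - h3
  have hiter (k : ℕ) : eulerField n (1 - (x + k)) - eulerField n (x + k) =
      (-1) ^ k * (eulerField n (1 - x) - eulerField n x) := by
    induction k with
    | zero => simp
    | succ k ih =>
      rw [Nat.cast_succ, ← add_assoc, hstep, ih]
      ring
  have h := hiter p
  rw [CharP.cast_eq_zero, add_zero, hp.neg_one_pow] at h
  have h5 : 2 * (eulerField n (1 - x) - eulerField n x) = 0 := by linear_combination h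
  exact sub_eq_zero.mp ((mul_eq_zero.mp h5).resolve_left h2)

lemma two_mul_alternating_sum_pow (h2 : (2 : K) ≠ 0) (m n : ℕ) :
    2 * ∑ i ∈ range n, (-1) ^ i * ((i : K) + 1) ^ m =
      eulerField m 1 - (-1) ^ n * eulerField m ((n : K) + 1) := by
  induction n with
  | zero => simp
  | succ n ih =>
    rw [sum_range_succ, mul_add, ih]
    have := eulerField_add_one_add h2 m ((n : K) + 1)
    push_cast
    linear_combination -(-1) ^ n * this

lemma choose_mul_choose_shift (n k : ℕ) :
    n.choose k * (n + 1 + k).choose (k + 1) = (n + 1).choose (k + 1) * (n + 1 + k).choose k := by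
  have h1 := Nat.add_one_mul_choose_eq n k
  have h2 := Nat.choose_succ_right_eq (n + 1 + k) k
  rw [Nat.add_sub_cancel] at h2
  apply Nat.eq_of_mul_eq_mul_right (show 0 < k + 1 by omega)
  calc _ = n.choose k * ((n + 1 + k).choose (k + 1) * (k + 1)) := by ring
    _ = ((n + 1) * n.choose k) * (n + 1 + k).choose k := by rw [h2]; ring
    _ = _ := by rw [h1]; ring

/-- The generalized harmonic number of order two in a field. -/
def harmonicTwo (K : Type*) [Field K] (n : ℕ) : K := ∑ i ∈ range n, 1 / ((i : K) + 1) ^ 2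

lemma sum_choose_mul_harmonicTwo_add (n M : ℕ) :
    ∑ k ∈ range (M + 1), (-1) ^ k * (((n + 1).choose k * (n + 1 + k).choose k : K) +
        n.choose k * (n + k).choose k) * harmonicTwo K k =
      2 * (-1) ^ M * (n.choose M * (n + 1 + M).choose M) * harmonicTwo K M -
        2 * ∑ k ∈ range M,
          (-1) ^ k * (n.choose k * (n + 1 + k).choose k : K) / ((k : K) + 1) ^ 2 := by
  induction M with
  | zero => simp [harmonicTwo]
  | succ M ih =>
    rw [sum_range_succ, ih, sum_range_succ]
    have hH : harmonicTwo K (M + 1) = harmonicTwo K M + 1 / ((M : K) + 1) ^ 2 := by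
      rw [harmonicTwo, sum_range_succ, ← harmonicTwo]
    have key : (n.choose M * (n + 1 + M).choose (M + 1) : K) =
        (n + 1).choose (M + 1) * (n + 1 + M).choose M := by
      have h := congrArg (Nat.cast (R := K)) (choose_mul_choose_shift n M)
      push_cast at h
      linear_combination h
    have e1 : ((n + 1).choose (M + 1) : K) = n.choose M + n.choose (M + 1) := by
      rw [Nat.choose_succ_succ]; push_cast; rfl
    have e2 : ((n + 1 + (M + 1)).choose (M + 1) : K) =
        (n + 1 + M).choose M + (n + 1 + M).choose (M + 1) := by
      rw [← add_assoc, Nat.choose_succ_succ]; push_cast; rfl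
    have e3 : n + (M + 1) = n + 1 + M := by ring
    rw [e3, e2, e1, hH]
    rw [e1] at key
    linear_combination ((-1) ^ (M + 1) * (harmonicTwo K M + 1 / ((M : K) + 1) ^ 2)) * key

lemma sum_neg_one_pow_choose_succ_mul (n M : ℕ) :
    ∑ k ∈ range M, (-1) ^ k * ((n + 1).choose (k + 1) * (n + 1 + k).choose (k + 1) : K) =
      1 - (-1) ^ M * (n.choose M * (n + 1 + M).choose M) := by
  induction M with
  | zero => simp
  | succ M ih =>
    rw [sum_range_succ, ih]
    have key : (n.choose M * (n + 1 + M).choose (M + 1) : K) =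
        (n + 1).choose (M + 1) * (n + 1 + M).choose M := by
      have h := congrArg (Nat.cast (R := K)) (choose_mul_choose_shift n M)
      push_cast at h
      linear_combination h
    have e1 : ((n + 1).choose (M + 1) : K) = n.choose M + n.choose (M + 1) := by
      rw [Nat.choose_succ_succ]; push_cast; rfl
    have e2 : ((n + 1 + (M + 1)).choose (M + 1) : K) =
        (n + 1 + M).choose M + (n + 1 + M).choose (M + 1) := by
      rw [← add_assoc, Nat.choose_succ_succ]; push_cast; rfl
    rw [e2, e1]
    rw [e1] at key
    linear_combination (-1) ^ M * key

lemma sum_choose_div_succ_sq {n M : ℕ} (hM : ∀ k < M, (k : K) + 1 ≠ 0) (hn : n < M) :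
    ∑ k ∈ range M, (-1) ^ k * (n.choose k * (n + 1 + k).choose k : K) / ((k : K) + 1) ^ 2 =
      1 / ((n : K) + 1) ^ 2 := by
  have hn0 := hM n hn
  have h := sum_neg_one_pow_choose_succ_mul (K := K) n M
  rw [Nat.choose_eq_zero_of_lt hn, Nat.cast_zero, zero_mul, mul_zero, sub_zero] at h
  calc _ = (∑ k ∈ range M, (-1) ^ k *
        ((n + 1).choose (k + 1) * (n + 1 + k).choose (k + 1) : K)) / ((n : K) + 1) ^ 2 := ?_
    _ = _ := by rw [h]
  rw [sum_div]
  refine sum_congr rfl fun k hk => ?_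
  have hk0 := hM k (mem_range.mp hk)
  have h1 : ((n : K) + 1) * n.choose k = (n + 1).choose (k + 1) * (k + 1) := by
    have h := congrArg (Nat.cast (R := K)) (Nat.add_one_mul_choose_eq n k)
    push_cast at h
    linear_combination h
  have h2 : ((n + 1 + k).choose (k + 1) : K) * (k + 1) = (n + 1 + k).choose k * (n + 1) := by
    have h3 := Nat.choose_succ_right_eq (n + 1 + k) k
    rw [Nat.add_sub_cancel] at h3
    have h := congrArg (Nat.cast (R := K)) (h3)
    push_cast at h
    linear_combination h
  rw [div_eq_div_iff (pow_ne_zero 2 hk0) (pow_ne_zero 2 hn0)]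
  linear_combination ((-1) ^ k * ((n : K) + 1) * (n + 1 + k).choose k) * h1 -
    ((-1) ^ k * ((n + 1).choose (k + 1) : K) * (k + 1)) * h2

lemma sum_choose_mul_harmonicTwo {M : ℕ} (hM : ∀ k < M, (k : K) + 1 ≠ 0) (n : ℕ) (hn : n ≤ M) :
    ∑ k ∈ range (M + 1), (-1) ^ k * (n.choose k * (n + k).choose k : K) * harmonicTwo K k =
      2 * (-1) ^ n * ∑ i ∈ range n, (-1) ^ i / ((i : K) + 1) ^ 2 := by
  induction n with
  | zero =>
    rw [sum_range_succ']
    simp [harmonicTwo]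
  | succ n ih =>
    have h := sum_choose_mul_harmonicTwo_add (K := K) n M
    rw [sum_choose_div_succ_sq hM hn, Nat.choose_eq_zero_of_lt hn] at h
    simp_rw [mul_add, add_mul] at h
    rw [sum_add_distrib, ih (by omega)] at h
    rw [sum_range_succ (fun i : ℕ => (-1 : K) ^ i / ((i : K) + 1) ^ 2)]
    have h1 : ((-1 : K) ^ n) * (-1) ^ n = 1 := by rw [← mul_pow]; simp
    push_cast at h
    linear_combination h + 2 / ((n : K) + 1) ^ 2 * h1

lemma succ_sq_mul_choose_four (k : ℕ) :
    (k + 1) ^ 2 * ((4 * (k + 1)).choose (2 * (k + 1)) * (2 * (k + 1)).choose (k + 1)) =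
      4 * (4 * k + 1) * (4 * k + 3) * ((4 * k).choose (2 * k) * (2 * k).choose k) := by
  have e (j : ℕ) : (4 * j).choose (2 * j) = (2 * j).centralBinom := by
    rw [Nat.centralBinom]; congr 1; ring
  have e' (j : ℕ) : (2 * j).choose j = j.centralBinom := rfl
  rw [e, e, e', e']
  have h1 := Nat.succ_mul_centralBinom_succ (2 * k)
  have h2 := Nat.succ_mul_centralBinom_succ (2 * k + 1)
  have h3 := Nat.succ_mul_centralBinom_succ k
  rw [show 2 * (k + 1) = 2 * k + 1 + 1 by ring]
  generalize Nat.centralBinom (2 * k + 1 + 1) = a at *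
  generalize Nat.centralBinom (2 * k + 1) = b at *
  generalize Nat.centralBinom (2 * k) = c at *
  generalize Nat.centralBinom (k + 1) = d at *
  generalize Nat.centralBinom k = f at *
  apply Nat.eq_of_mul_eq_mul_left (show 0 < 2 * (2 * k + 1) by positivity)
  zify at *
  linear_combination ((2 * k + 1) * (k + 1) * d : ℤ) * h2 +
    (2 * (4 * k + 3) * (k + 1) * d : ℤ) * h1 + (4 * (4 * k + 3) * (4 * k + 1) * c : ℤ) * h3

lemma choose_four_div_eq {n M : ℕ} (h2 : (2 : K) ≠ 0) (hM : ∀ k < M, (k : K) + 1 ≠ 0)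
    (hn : 16 * (n : K) * (n + 1) = -3) (k : ℕ) (hk : k ≤ M) :
    ((4 * k).choose (2 * k) : K) * (2 * k).choose k / 64 ^ k =
      (-1) ^ k * (n.choose k * (n + k).choose k) := by
  induction k with
  | zero => simp
  | succ k ih =>
    have h64 : (64 : K) ≠ 0 := by
      rw [show (64 : K) = 2 ^ 6 by norm_num]; exact pow_ne_zero _ h2
    have hk0 := hM k hk
    have ih := ih (by omega)
    have h1 : ((k : K) + 1) ^ 2 *
        (((4 * (k + 1)).choose (2 * (k + 1)) : K) * (2 * (k + 1)).choose (k + 1)) =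
        4 * (4 * k + 1) * (4 * k + 3) * ((4 * k).choose (2 * k) * (2 * k).choose k) := by
      have h := congrArg (Nat.cast (R := K)) (succ_sq_mul_choose_four k)
      push_cast at h
      linear_combination h
    have h3 : (n.choose (k + 1) : K) * (k + 1) = n.choose k * (n - k) := by
      rcases le_or_gt k n with h | h
      · have := Nat.choose_succ_right_eq n k
        rw [← Nat.cast_sub h]
        simpa using congrArg (Nat.cast (R := K)) this
      · simp [Nat.choose_eq_zero_of_lt h, Nat.choose_eq_zero_of_lt (Nat.lt_succ_of_lt h)]
    have h4 : ((n + (k + 1)).choose (k + 1) : K) * (k + 1) = (n + k + 1) * (n + k).choose k := by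
      have h := congrArg (Nat.cast (R := K)) (Nat.add_one_mul_choose_eq (n + k) k)
      push_cast at h
      rw [← add_assoc]
      linear_combination -h
    rw [div_eq_iff (pow_ne_zero _ h64)] at ih ⊢
    apply mul_left_cancel₀ (pow_ne_zero 2 hk0)
    rw [h1, ih]
    generalize (n.choose (k + 1) : K) = a at *
    generalize ((n + (k + 1)).choose (k + 1) : K) = b at *
    generalize (n.choose k : K) = c at *
    generalize ((n + k).choose k : K) = d at *
    rw [pow_succ, pow_succ (64 : K)]
    linear_combination ((-1) ^ k * 64 ^ k * 64 * b * (k + 1)) * h3 +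
      ((-1) ^ k * 64 ^ k * 64 * c * (n - k)) * h4 + (4 * (-1) ^ k * 64 ^ k * c * d) * hn

end Field

/-- `IsReductionMod p q z` says that the rational `q` has denominator coprime to `p` and reduces
to `z` modulo `p`. -/
def IsReductionMod (p : ℕ) (q : ℚ) (z : ZMod p) : Prop :=
  ∃ a b : ℤ, (b : ZMod p) ≠ 0 ∧ q = a / b ∧ z * b = a

namespace IsReductionMod

variable {p : ℕ} [Fact p.Prime] {q r : ℚ} {z w : ZMod p}

lemma cast_ne_zero {b : ℤ} (hb : (b : ZMod p) ≠ 0) : (b : ℚ) ≠ 0 := by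
  rintro h
  rw [Int.cast_eq_zero] at h
  simp [h] at hb

lemma natCast (n : ℕ) : IsReductionMod p n n := ⟨n, 1, by simp, by simp, by simp⟩

lemma one : IsReductionMod p 1 1 := ⟨1, 1, by simp, by simp, by simp⟩

lemma ofNat (n : ℕ) [n.AtLeastTwo] : IsReductionMod p (ofNat(n) : ℚ) ofNat(n) := natCast n

lemma add (h : IsReductionMod p q z) (h' : IsReductionMod p r w) :
    IsReductionMod p (q + r) (z + w) := by
  obtain ⟨a, b, hb, rfl, h1⟩ := h
  obtain ⟨c, d, hd, rfl, h2⟩ := h'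
  refine ⟨a * d + b * c, b * d, by push_cast; exact mul_ne_zero hb hd, ?_, ?_⟩
  · rw [div_add_div _ _ (cast_ne_zero hb) (cast_ne_zero hd)]; push_cast; rfl
  · push_cast; linear_combination (d : ZMod p) * h1 + (b : ZMod p) * h2

lemma neg (h : IsReductionMod p q z) : IsReductionMod p (-q) (-z) := by
  obtain ⟨a, b, hb, rfl, h1⟩ := h
  exact ⟨-a, b, hb, by push_cast; ring, by push_cast; linear_combination -h1⟩

lemma mul (h : IsReductionMod p q z) (h' : IsReductionMod p r w) :
    IsReductionMod p (q * r) (z * w) := by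
  obtain ⟨a, b, hb, rfl, h1⟩ := h
  obtain ⟨c, d, hd, rfl, h2⟩ := h'
  refine ⟨a * c, b * d, by push_cast; exact mul_ne_zero hb hd, ?_, ?_⟩
  · rw [div_mul_div_comm]; push_cast; rfl
  · push_cast; rw [← h1, ← h2]; ring

lemma inv (h : IsReductionMod p q z) (hz : z ≠ 0) : IsReductionMod p q⁻¹ z⁻¹ := by
  obtain ⟨a, b, hb, rfl, h1⟩ := h
  exact ⟨b, a, by rw [← h1]; exact mul_ne_zero hz hb, by rw [inv_div],
    by rw [← h1, inv_mul_cancel_left₀ hz]⟩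

lemma div (h : IsReductionMod p q z) (h' : IsReductionMod p r w) (hw : w ≠ 0) :
    IsReductionMod p (q / r) (z / w) := by
  simpa only [div_eq_mul_inv] using h.mul (h'.inv hw)

lemma pow (h : IsReductionMod p q z) (n : ℕ) : IsReductionMod p (q ^ n) (z ^ n) := by
  induction n with
  | zero => simpa using one
  | succ n ih => simpa only [pow_succ] using ih.mul h

lemma sum {ι : Type*} (s : Finset ι) {f : ι → ℚ} {g : ι → ZMod p}
    (h : ∀ i ∈ s, IsReductionMod p (f i) (g i)) :
    IsReductionMod p (∑ i ∈ s, f i) (∑ i ∈ s, g i) := by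
  classical
  induction s using Finset.induction_on with
  | empty => simpa using natCast 0
  | insert a s ha ih =>
    rw [sum_insert ha, sum_insert ha]
    exact (h a (mem_insert_self a s)).add (ih fun i hi => h i (mem_insert_of_mem hi))

lemma dvd_num (h : IsReductionMod p q 0) : (p : ℤ) ∣ q.num := by
  obtain ⟨a, b, hb, hq, h1⟩ := h
  rw [zero_mul, eq_comm] at h1
  have h2 : q.num * b = a * q.den := by
    have hd : (q.den : ℚ) ≠ 0 := by exact_mod_cast q.den_ne_zero
    have h3 : (q.num : ℚ) / q.den = a / b := by rw [Rat.num_div_den, hq]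
    rw [div_eq_div_iff hd (cast_ne_zero hb)] at h3
    exact_mod_cast h3
  have h4 : ((q.num * b : ℤ) : ZMod p) = 0 := by rw [h2]; push_cast; rw [h1, zero_mul]
  push_cast at h4
  exact (ZMod.intCast_zmod_eq_zero_iff_dvd _ p).mp ((mul_eq_zero.mp h4).resolve_right hb)

lemma eulerE (h2 : (2 : ZMod p) ≠ 0) (h : IsReductionMod p q z) (n : ℕ) :
    IsReductionMod p (eulerE n q) (eulerField n z) := by
  refine sum _ fun k _ => (one.div ((ofNat 2).pow k) (pow_ne_zero k h2)).mul ?_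
  exact sum _ fun j _ => ((one.neg.pow j).mul (natCast _)).mul ((h.add (natCast j)).pow n)

lemma H2 {n : ℕ} (hn : ∀ k < n, (k : ZMod p) + 1 ≠ 0) :
    IsReductionMod p (H2 n) (harmonicTwo (ZMod p) n) :=
  sum _ fun i hi => one.div (((natCast i).add one).pow 2)
    (pow_ne_zero 2 (hn i (mem_range.mp hi)))

end IsReductionMod

lemma sum_choose_four_harmonicTwo_eq {p : ℕ} [Fact p.Prime] (hp3 : 3 < p) :
    ∑ k ∈ Icc 1 ((p - 1) / 4), ((4 * k).choose (2 * k) : ZMod p) * ((2 * k).choose k : ZMod p) *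
      harmonicTwo (ZMod p) k / 64 ^ k = -eulerField (p - 3) (1 / 4) := by
  have hp : p.Prime := Fact.out
  have hodd : p % 2 = 1 := (hp.eq_two_or_odd).resolve_left (by omega)
  have hne {k : ℕ} (h0 : 0 < k) (hk : k < p) : (k : ZMod p) ≠ 0 := by
    rw [Ne, ZMod.natCast_eq_zero_iff]
    exact Nat.not_dvd_of_pos_of_lt h0 hk
  have h2 : (2 : ZMod p) ≠ 0 := by exact_mod_cast hne (k := 2) (by omega) (by omega)
  have h4 : (4 : ZMod p) ≠ 0 := by exact_mod_cast hne (k := 4) (by omega) (by omega)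
  obtain ⟨n, hn⟩ : ∃ n, n = (p - 1) / 4 := ⟨_, rfl⟩
  rw [← hn]
  have hM : ∀ k < n, (k : ZMod p) + 1 ≠ 0 := fun k hk => by
    exact_mod_cast hne (k := k + 1) (by omega) (by omega)
  have heven : Even (p - 3) := by rw [Nat.even_iff]; omega
  have hrefl := eulerField_one_sub (K := ZMod p) p (Nat.odd_iff.mpr hodd) h2 heven
  have hcases : p = 4 * n + 1 ∨ p = 4 * n + 3 := by omega
  have hfour : 4 * (n : ZMod p) = -1 ∨ 4 * (n : ZMod p) = -3 := by
    rcases hcases with h | h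
    · left
      have h0 := congrArg (Nat.cast (R := ZMod p)) h
      push_cast [CharP.cast_eq_zero] at h0
      linear_combination -h0
    · right
      have h0 := congrArg (Nat.cast (R := ZMod p)) h
      push_cast [CharP.cast_eq_zero] at h0
      linear_combination -h0
  have h16 : 16 * (n : ZMod p) * (n + 1) = -3 := by
    rcases hfour with h | h
    · linear_combination (4 * (n : ZMod p) + 3) * h
    · linear_combination (4 * (n : ZMod p) + 1) * h
  have hquarter : eulerField (p - 3) ((n : ZMod p) + 1) = eulerField (p - 3) (1 / 4) := by
    rcases hfour with h | h
    · rw [← hrefl (1 / 4)]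
      congr 1
      field_simp
      linear_combination h
    · congr 1
      field_simp
      linear_combination h
  have hone : eulerField (p - 3) (1 : ZMod p) = 0 := by
    have h := eulerField_add_one_add h2 (p - 3) (0 : ZMod p)
    have h' := hrefl 0
    rw [sub_zero] at h'
    rw [zero_add, ← h', zero_pow (by omega), mul_zero, ← two_mul] at h
    exact (mul_eq_zero.mp h).resolve_left h2
  have hpow : ∀ i ∈ range n, (-1 : ZMod p) ^ i / ((i : ZMod p) + 1) ^ 2 =
      (-1) ^ i * ((i : ZMod p) + 1) ^ (p - 3) := fun i hi => by
    have hi0 := hM i (mem_range.mp hi)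
    rw [div_eq_iff (pow_ne_zero 2 hi0), mul_assoc, ← pow_add, show p - 3 + 2 = p - 1 by omega,
      ZMod.pow_card_sub_one_eq_one hi0, mul_one]
  have hsum := sum_choose_mul_harmonicTwo hM n le_rfl
  rw [sum_congr rfl hpow, mul_right_comm, two_mul_alternating_sum_pow h2, hone, hquarter] at hsum
  have hlhs : ∑ k ∈ Icc 1 n, ((4 * k).choose (2 * k) : ZMod p) * ((2 * k).choose k : ZMod p) *
      harmonicTwo (ZMod p) k / 64 ^ k =
      ∑ k ∈ range (n + 1), (-1) ^ k * (n.choose k * (n + k).choose k : ZMod p) *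
        harmonicTwo (ZMod p) k := by
    rw [range_eq_Ico, sum_eq_sum_Ico_succ_bot (Nat.succ_pos n)]
    simp only [harmonicTwo, range_zero, sum_empty, mul_zero, zero_add]
    refine sum_congr rfl fun k hk => ?_
    rw [← choose_four_div_eq h2 hM h16 k (by rw [mem_Ico] at hk; omega)]
    ring
  have h1 : ((-1 : ZMod p) ^ n) * (-1) ^ n = 1 := by rw [← mul_pow]; simp
  rw [hlhs, hsum]
  linear_combination -eulerField (p - 3) (1 / 4 : ZMod p) * h1

/-- Lemma 2.6, second congruence (Mao): for any prime `p > 3`,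
`∑_{k=1}^{⌊(p-1)/4⌋} C(4k,2k) C(2k,k) H_k⁽²⁾ / 64^k ≡ -E_{p-3}(1/4) (mod p)`. -/
theorem sum_central_choose_H2_congr_eulerE (p : ℕ) (hp : p.Prime) (hp3 : 3 < p) :
    ((p : ℤ)) ∣
      ((∑ k ∈ Finset.Icc 1 ((p - 1) / 4),
          ((4 * k).choose (2 * k) : ℚ) * ((2 * k).choose k : ℚ) * H2 k / 64 ^ k) -
        (-eulerE (p - 3) (1 / 4))).num := by
  have : Fact p.Prime := ⟨hp⟩
  have hne {k : ℕ} (h0 : 0 < k) (hk : k < p) : (k : ZMod p) ≠ 0 := by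
    rw [Ne, ZMod.natCast_eq_zero_iff]
    exact Nat.not_dvd_of_pos_of_lt h0 hk
  have h2 : (2 : ZMod p) ≠ 0 := by exact_mod_cast hne (k := 2) (by omega) (by omega)
  have h4 : (4 : ZMod p) ≠ 0 := by
    rw [show (4 : ZMod p) = 2 ^ 2 by norm_num]; exact pow_ne_zero _ h2
  have h64 : (64 : ZMod p) ≠ 0 := by
    rw [show (64 : ZMod p) = 2 ^ 6 by norm_num]; exact pow_ne_zero _ h2
  have hE := IsReductionMod.eulerE h2 (IsReductionMod.one.div (IsReductionMod.ofNat 4) h4) (p - 3)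
  have hH (k : ℕ) (hk : k ∈ Icc 1 ((p - 1) / 4)) :
      IsReductionMod p (H2 k) (harmonicTwo (ZMod p) k) := by
    refine IsReductionMod.H2 fun j hj => ?_
    rw [mem_Icc] at hk
    have hlt : j + 1 < p := by omega
    exact_mod_cast hne (Nat.succ_pos j) hlt
  have hS := IsReductionMod.sum (p := p) (Icc 1 ((p - 1) / 4)) fun k hk =>
    (((IsReductionMod.natCast ((4 * k).choose (2 * k))).mul
      (IsReductionMod.natCast ((2 * k).choose k))).mul (hH k hk)).div
      ((IsReductionMod.ofNat 64).pow k) (pow_ne_zero k h64)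
  rw [sum_choose_four_harmonicTwo_eq hp3] at hS
  apply IsReductionMod.dvd_num
  rw [sub_neg_eq_add]
  simpa using hS.add hE
end

section
/- Let p > 3 be a prime. Then sum_{k=1}^{(p-1)/2} G((p+1)/2, k) ≡ p*(-1|p) + (p^3/4)*(2|p)*E_{p-3}(1/4) (mod p^4), where G(n,k) = (-1)^{n+1} n C(2n,n) C(2n-2k,n-k) C(2n-2k,n-1) / 2^{3n-2k} (with G(n,k) = 0 for n < k), and the congruence is between rational numbers whose denominators are coprime to p. -/
/-- `G(n,k) = (-1)^{n+1} n C(2n,n) C(2n-2k,n-k) C(2n-2k,n-1) / 2^{3n-2k}`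
for `n ≥ k`, and `G(n,k) = 0` for `n < k`. -/
def G (n k : ℕ) : ℚ :=
  if n < k then 0 else
    (-1) ^ (n + 1) * (n : ℚ) * ((2 * n).choose n) *
      ((2 * n - 2 * k).choose (n - k)) * ((2 * n - 2 * k).choose (n - 1)) / 2 ^ (3 * n - 2 * k)


open Finset

theorem Ring.choose_succ_right_rat (x : ℚ) (r : ℕ) :
    Ring.choose x (r + 1) = Ring.choose x r * (x - r) / (r + 1) := by
  have h := Ring.choose_smul_choose x (Nat.le_succ r)
  simp only [Nat.succ_eq_add_one, Nat.add_sub_cancel_left, Ring.choose_one_right,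
    Nat.choose_succ_self_right, nsmul_eq_mul] at h
  push_cast at h
  field_simp
  linarith

theorem Ring.choose_sub_one_mul (x : ℚ) (r : ℕ) :
    Ring.choose (x - 1) r * x = (x - r) * Ring.choose x r := by
  induction r with
  | zero => simp
  | succ r ih =>
    rw [Ring.choose_succ_right_rat, Ring.choose_succ_right_rat]
    push_cast
    field_simp
    linear_combination (x - 1 - r) * ih

/-- The terminating hypergeometric sum `∑ᵣ C(a,r) C(t-a-1,r) t/(t-r)`. -/
noncomputable def hypSum (a : ℕ) (t : ℚ) : ℚ :=
  ∑ r ∈ range (a + 1), (a.choose r : ℚ) * Ring.choose (t - a - 1) r * (t / (t - r))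

/-- The product `∏ (1 - t/k)` over `1 ≤ k ≤ a`. -/
def qProd (t : ℚ) (a : ℕ) : ℚ := ∏ k ∈ range a, (1 - t / (k + 1))

theorem sum_choose_mul_choose (a : ℕ) (x : ℚ) :
    ∑ r ∈ range (a + 1), (a.choose r : ℚ) * Ring.choose x r = Ring.choose (x + a) a := by
  rw [Ring.add_choose_eq a (Commute.all x (a : ℚ)),
    Nat.sum_antidiagonal_eq_sum_range_succ (fun i j => Ring.choose x i * Ring.choose (a : ℚ) j)]
  refine sum_congr rfl fun r hr => ?_
  rw [Ring.choose_natCast, Nat.choose_symm (by simpa [Nat.lt_succ_iff] using hr), mul_comm]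

theorem hypSum_succ (a : ℕ) (t : ℚ) (ht : ∀ n : ℕ, t ≠ n) :
    (t - (a + 1)) ^ 2 * hypSum (a + 1) t =
      (a + 1) ^ 2 * hypSum a t + t * (t - 2 * (a + 1)) * Ring.choose t (a + 1) := by
  have hV := sum_choose_mul_choose (a + 1) (t - (a + 1 : ℕ))
  rw [sub_add_cancel] at hV
  have hF : hypSum a t = ∑ r ∈ range (a + 1 + 1),
      (a.choose r : ℚ) * Ring.choose (t - a - 1) r * (t / (t - r)) := by
    rw [sum_range_succ _ (a + 1), hypSum]; simp
  rw [← hV, hF, hypSum, mul_sum, mul_sum, mul_sum, ← sum_add_distrib]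
  refine sum_congr rfl fun r hr => ?_
  have hr' : r ≤ a + 1 := by simpa [Nat.lt_succ_iff] using hr
  have h1 : ((a + 1).choose r : ℚ) * (a + 1 - r) = (a + 1) * a.choose r := by
    have := Nat.choose_mul_succ_eq a r
    rw [← Nat.cast_inj (R := ℚ)] at this
    push_cast [Nat.cast_sub hr'] at this
    linarith
  have h2 := Ring.choose_sub_one_mul (t - (a + 1 : ℕ)) r
  have e : t - a - 1 = t - (a + 1 : ℕ) := by push_cast; ring
  rw [e]
  have h3 : t - r ≠ 0 := sub_ne_zero.2 (ht r)
  have h4 : t - (a + 1) ≠ 0 := sub_ne_zero.2 (by exact_mod_cast ht (a + 1))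
  push_cast at h2 ⊢
  field_simp
  linear_combination t * ((a + 1).choose r : ℚ) * (t - (a + 1)) * h2 +
    t * Ring.choose (t - (a + 1)) r * (a + 1) * h1

theorem choose_succ_eq_qProd (t : ℚ) (a : ℕ) :
    Ring.choose t (a + 1) = t / (a + 1) * (-1) ^ a * qProd t a := by
  induction a with
  | zero => simp [qProd]
  | succ a ih =>
    rw [Ring.choose_succ_right_rat, ih, qProd, qProd, prod_range_succ]
    push_cast
    field_simp
    ring

/-- The alternating sum which measures the deviation of `qProd t a ^ 2 * hypSum a t` from `1`. -/
def deviation (t : ℚ) (a : ℕ) : ℚ :=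
  ∑ k ∈ range a, (-1) ^ (k + 1) * (1 / (k + 1)) ^ 2 * (2 - t / (k + 1)) * qProd t k ^ 3

theorem qProd_sq_mul_hypSum (a : ℕ) (t : ℚ) (ht : ∀ n : ℕ, t ≠ n) :
    qProd t a ^ 2 * hypSum a t = 1 + t ^ 2 * deviation t a := by
  induction a with
  | zero =>
    have : t ≠ 0 := by simpa using ht 0
    simp [qProd, hypSum, deviation, this]
  | succ a ih =>
    have h := hypSum_succ a t ht
    rw [choose_succ_eq_qProd] at h
    have e : qProd t (a + 1) = qProd t a * (1 - t / (a + 1)) := by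
      rw [qProd, prod_range_succ, ← qProd]
    have e2 : qProd t (a + 1) ^ 2 * hypSum (a + 1) t =
        qProd t a ^ 2 / (a + 1) ^ 2 * ((t - (a + 1)) ^ 2 * hypSum (a + 1) t) := by
      rw [e]; field_simp; ring
    rw [deviation, sum_range_succ, ← deviation, mul_add, ← add_assoc, ← ih, e2, h]
    field_simp
    ring

theorem sum_centralBinom_mul_choose (m i : ℕ) :
    ∑ j ∈ range (m + 1), (j.centralBinom : ℚ) / 4 ^ j * j.choose i =
      (2 * m + 1) * (m.centralBinom / 4 ^ m) * m.choose i / (2 * i + 1) := by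
  induction m with
  | zero => rcases i with _ | i <;> simp
  | succ m ih =>
    rw [sum_range_succ, ih]
    have h1 : (m.choose i : ℚ) * (m + 1) = (m + 1).choose i * (m + 1 - i) := by
      rcases le_or_gt i (m + 1) with h | h
      · have := Nat.choose_mul_succ_eq m i
        rw [← Nat.cast_inj (R := ℚ)] at this
        push_cast [Nat.cast_sub h] at this
        exact this
      · rw [Nat.choose_eq_zero_of_lt h, Nat.choose_eq_zero_of_lt (by omega)]; simp
    have h2 : ((m : ℚ) + 1) * (m + 1).centralBinom = 2 * (2 * m + 1) * m.centralBinom := by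
      exact_mod_cast Nat.succ_mul_centralBinom_succ m
    have h3 : ((m + 1).centralBinom : ℚ) = 2 * (2 * m + 1) * m.centralBinom / (m + 1) := by
      field_simp; linarith
    rw [h3]
    push_cast
    field_simp
    linear_combination 4 * 4 ^ m * (m.centralBinom : ℚ) * h1

theorem choose_two_mul_eq_sum (j m : ℕ) :
    (2 * j).choose m =
      ∑ i ∈ range (m + 1), j.choose i * (2 ^ (i - (m - i)) * i.choose (m - i)) := by
  open Polynomial in
  have h : ((1 : ℕ[X]) + X) ^ (2 * j) = (X * (X + C 2) + 1) ^ j := by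
    rw [pow_mul]
    congr 1
    rw [show (C 2 : ℕ[X]) = 2 from rfl]
    ring
  have h2 := Polynomial.coeff_one_add_X_pow ℕ (2 * j) m
  rw [h, add_pow] at h2
  simp only [one_pow, mul_one, mul_pow,
    Polynomial.finsetSum_coeff, Polynomial.coeff_mul_natCast, Polynomial.coeff_X_pow_mul',
    Polynomial.coeff_X_add_C_pow, Nat.cast_id] at h2
  rw [← h2]
  trans ∑ i ∈ range (j + m + 1), j.choose i * (2 ^ (i - (m - i)) * i.choose (m - i)) *
    (if i ≤ m then 1 else 0)
  · rw [← sum_subset (range_mono (by omega : j + 1 ≤ j + m + 1))]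
    · refine sum_congr rfl fun i _ => ?_
      split_ifs <;> simp [mul_comm]
    · intro i _ hi
      rw [Nat.choose_eq_zero_of_lt (by simpa using hi)]; simp
  · symm
    rw [← sum_subset (range_mono (by omega : m + 1 ≤ j + m + 1))]
    · refine sum_congr rfl fun i hi => ?_
      rw [if_pos (by simpa [Nat.lt_succ_iff] using hi), mul_one]
    · intro i _ hi
      rw [if_neg (by simpa using hi), mul_zero]

theorem choose_mul_choose_sub (m r : ℕ) :
    (m.choose r : ℚ) * (m - r).choose r =
      4 ^ r * ((m / 2).choose r * Ring.choose ((m : ℚ) + 1 / 2 - (m / 2 : ℕ) - 1) r) := by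
  have h1 : (m.descFactorial (2 * r) : ℚ) =
      (r.factorial) ^ 2 * (m.choose r * (m - r).choose r) := by
    rw [← Nat.descFactorial_mul_descFactorial (show r ≤ 2 * r by omega),
      show 2 * r - r = r by omega, Nat.descFactorial_eq_factorial_mul_choose,
      Nat.descFactorial_eq_factorial_mul_choose]
    push_cast
    ring
  have hd (n k : ℕ) : (n.descFactorial (k + 1) : ℚ) = (n - k) * n.descFactorial k := by
    rw [Nat.descFactorial_succ]
    rcases le_or_gt k n with h | h
    · push_cast [Nat.cast_sub h]; rfl
    · rw [Nat.descFactorial_eq_zero_iff_lt.2 h]; simp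
  have h2 : (m.descFactorial (2 * r) : ℚ) = (r.factorial) ^ 2 *
      (4 ^ r * ((m / 2).choose r * Ring.choose ((m : ℚ) + 1 / 2 - (m / 2 : ℕ) - 1) r)) := by
    clear h1
    induction r with
    | zero => simp
    | succ r ih =>
      rw [show 2 * (r + 1) = 2 * r + 1 + 1 by ring, hd, hd, ih]
      simp only [← Ring.choose_natCast (R := ℚ), Ring.choose_succ_right_rat, Nat.factorial_succ]
      rcases Nat.even_or_odd' m with ⟨a, rfl | rfl⟩
      · rw [show 2 * a / 2 = a by omega]
        push_cast
        field_simp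
        ring
      · rw [show (2 * a + 1) / 2 = a by omega]
        push_cast
        field_simp
        ring
  have h3 : (r.factorial : ℚ) ^ 2 ≠ 0 := by positivity
  exact mul_left_cancel₀ h3 (h1.symm.trans h2)

theorem sum_centralBinom_mul_choose_two_mul (m : ℕ) :
    ∑ j ∈ range (m + 1), (j.centralBinom : ℚ) / 4 ^ j * (2 * j).choose m =
      m.centralBinom / 2 ^ m * hypSum (m / 2) (m + 1 / 2) := by
  simp only [choose_two_mul_eq_sum, Nat.cast_sum, mul_sum]
  rw [sum_comm]
  have h (i : ℕ) : ∑ j ∈ range (m + 1), (j.centralBinom : ℚ) / 4 ^ j *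
      ((j.choose i * (2 ^ (i - (m - i)) * i.choose (m - i)) : ℕ) : ℚ) =
      (2 * m + 1) * (m.centralBinom / 4 ^ m) * m.choose i / (2 * i + 1) *
        (2 ^ (i - (m - i)) * i.choose (m - i)) := by
    rw [← sum_centralBinom_mul_choose, sum_mul]
    refine sum_congr rfl fun j _ => ?_
    push_cast
    ring
  simp only [h]
  rw [← sum_range_reflect, hypSum, mul_sum]
  symm
  refine sum_subset_zero_on_sdiff (range_mono (by omega)) ?_ ?_
  · intro r hr
    simp only [mem_sdiff, mem_range] at hr
    rw [Nat.choose_eq_zero_of_lt (show m + 1 - 1 - r < m - (m + 1 - 1 - r) by omega)]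
    simp
  · intro r hr
    have hr' : 2 * r ≤ m := by have := mem_range.1 hr; omega
    rw [show m + 1 - 1 - r = m - r by omega, show m - (m - r) = r by omega,
      Nat.choose_symm (by omega : r ≤ m), Nat.cast_sub (by omega : r ≤ m)]
    have e := choose_mul_choose_sub m r
    have h4 : (4 : ℚ) ^ m = 2 ^ (m - r - r) * 2 ^ m * 4 ^ r := by
      rw [show (4 : ℚ) = 2 ^ 2 by norm_num, ← pow_mul, ← pow_mul, ← pow_add, ← pow_add]
      congr 1; omega
    have h5 : (m : ℚ) + 1 / 2 - r ≠ 0 := by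
      have : (r : ℚ) ≤ m := by exact_mod_cast (by omega : r ≤ m)
      linarith
    have h6 : 2 * ((m : ℚ) - r) + 1 ≠ 0 := fun h => h5 (by linarith)
    trans (m.centralBinom / 4 ^ m * 2 ^ (m - r - r) : ℚ) *
      ((2 * m + 1) / (2 * ((m : ℚ) - r) + 1)) * (m.choose r * (m - r).choose r)
    · rw [e, h4, show ((m : ℚ) + 1 / 2) / (m + 1 / 2 - r) = (2 * m + 1) / (2 * (m - r) + 1) by
        rw [div_eq_div_iff h5 h6]; ring]
      field_simp
    · field_simp

theorem qProd_mul_factorial (m j : ℕ) (hj : j ≤ m) :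
    qProd (m + 1 / 2) j * ((-4) ^ j * j.factorial * m.factorial * (2 * (m - j)).factorial) =
      (2 * m).factorial * (m - j).factorial := by
  induction j with
  | zero => simp [qProd]; ring
  | succ j ih =>
    have ih := ih (by omega)
    obtain ⟨d, rfl⟩ := Nat.exists_eq_add_of_le hj
    rw [show j + 1 + d - j = d + 1 by omega, show 2 * (d + 1) = 2 * d + 1 + 1 by ring] at ih
    rw [show j + 1 + d - (j + 1) = d by omega, qProd, prod_range_succ, ← qProd]
    simp only [Nat.factorial_succ] at ih ⊢
    have hd : (d : ℚ) + 1 ≠ 0 := by positivity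
    generalize qProd ((j + 1 + d : ℕ) + 1 / 2) j = q at ih ⊢
    push_cast at ih ⊢
    have ih' : q * ((-4) ^ j * j.factorial * (j + 1 + d).factorial *
        (2 * (2 * d + 1) * (2 * d).factorial)) =
        (2 * (j + 1 + d)).factorial * d.factorial :=
      mul_left_cancel₀ hd (by linear_combination ih)
    rw [pow_succ]
    field_simp
    linear_combination 2 * ih'

theorem qProd_half (m : ℕ) :
    qProd (m + 1 / 2) (m / 2) * (-1) ^ (m / 2) = m.centralBinom / 2 ^ m := by
  have h := qProd_mul_factorial m (m / 2) (Nat.div_le_self _ _)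
  have hc : (m.centralBinom : ℚ) * m.factorial * m.factorial = (2 * m).factorial := by
    have := Nat.choose_mul_factorial_mul_factorial (show m ≤ 2 * m by omega)
    rw [show 2 * m - m = m by omega] at this
    exact_mod_cast this
  rw [← hc] at h
  have hm : (m.factorial : ℚ) ≠ 0 := by positivity
  have ha : ((m / 2).factorial : ℚ) ≠ 0 := by positivity
  rw [show (-4 : ℚ) = -1 * 2 ^ 2 by norm_num, mul_pow, ← pow_mul] at h
  rw [eq_div_iff (by positivity)]
  rcases Nat.even_or_odd' m with ⟨a, ha' | ha'⟩
  · rw [show 2 * (m - m / 2) = m by omega, show m - m / 2 = m / 2 by omega,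
      show 2 * (m / 2) = m by omega] at h
    apply mul_right_cancel₀ (mul_ne_zero (mul_ne_zero hm hm) ha)
    linear_combination h
  · rw [show 2 * (m - m / 2) = m + 1 by omega, show m - m / 2 = m / 2 + 1 by omega,
      Nat.factorial_succ m, Nat.factorial_succ (m / 2)] at h
    have e : (m : ℚ) + 1 = 2 * ((m / 2 : ℕ) + 1) := by
      have : m + 1 = 2 * (m / 2 + 1) := by omega
      exact_mod_cast this
    have hz : ((m / 2 : ℕ) : ℚ) + 1 ≠ 0 := by positivity
    have e2 : (2 : ℚ) ^ m = 2 * 2 ^ (2 * (m / 2)) := by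
      rw [← pow_succ']; congr 1; omega
    apply mul_right_cancel₀ (mul_ne_zero (mul_ne_zero (mul_ne_zero hm hm) ha) hz)
    push_cast at h
    rw [e] at h
    rw [e2]
    linear_combination h

theorem sum_G_eq (m : ℕ) (hm : 0 < m) :
    ∑ k ∈ Icc 1 m, G (m + 1) k =
      (2 * m + 1) * (-1) ^ m *
        (1 + ((m : ℚ) + 1 / 2) ^ 2 * deviation (m + 1 / 2) (m / 2)) := by
  have ht (n : ℕ) : (m : ℚ) + 1 / 2 ≠ n := by
    intro h
    have : 2 * m + 1 = 2 * n := by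
      have : (2 * m + 1 : ℚ) = 2 * n := by linarith
      exact_mod_cast this
    omega
  have hT := sum_centralBinom_mul_choose_two_mul m
  have hB := qProd_half m
  have hs : ((-1 : ℚ) ^ (m / 2)) ^ 2 = 1 := by rw [← pow_mul, mul_comm, pow_mul]; simp
  have key : (m.centralBinom : ℚ) / 2 ^ m *
      ∑ j ∈ range (m + 1), (j.centralBinom : ℚ) / 4 ^ j * (2 * j).choose m =
      1 + ((m : ℚ) + 1 / 2) ^ 2 * deviation (m + 1 / 2) (m / 2) := by
    rw [hT, ← qProd_sq_mul_hypSum _ _ ht, ← hB]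
    linear_combination (qProd (m + 1 / 2) (m / 2)) ^ 2 * hypSum (m / 2) (m + 1 / 2) * hs
  rw [← key]
  have hr : ∑ k ∈ Icc 1 m, G (m + 1) k = ∑ j ∈ Icc 1 m, G (m + 1) (m + 1 - j) := by
    refine sum_nbij' (fun k => m + 1 - k) (fun k => m + 1 - k) ?_ ?_ ?_ ?_ ?_ <;>
      intro k hk <;> simp only [mem_Icc] at * <;> try omega
    rw [show m + 1 - (m + 1 - k) = k by omega]
  have hr2 : ∑ j ∈ range (m + 1), (j.centralBinom : ℚ) / 4 ^ j * (2 * j).choose m =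
      ∑ j ∈ Icc 1 m, (j.centralBinom : ℚ) / 4 ^ j * (2 * j).choose m := by
    symm
    refine sum_subset (fun j hj => ?_) (fun j hj hj' => ?_)
    · simp only [mem_Icc, mem_range] at *; omega
    · simp only [mem_Icc, mem_range] at *
      rw [Nat.choose_eq_zero_of_lt (by omega : 2 * j < m)]; simp
  rw [hr, hr2, mul_sum, mul_sum]
  refine sum_congr rfl fun j hj => ?_
  have hj' := mem_Icc.1 hj
  have hc : ((m : ℚ) + 1) * ((2 * (m + 1)).choose (m + 1)) = 2 * (2 * m + 1) * m.centralBinom := by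
    exact_mod_cast Nat.succ_mul_centralBinom_succ m
  rw [G, if_neg (by omega), show 2 * (m + 1) - 2 * (m + 1 - j) = 2 * j by omega,
    show m + 1 - (m + 1 - j) = j by omega, Nat.add_sub_cancel,
    show 3 * (m + 1) - 2 * (m + 1 - j) = m + 1 + 2 * j by omega, Nat.centralBinom_eq_two_mul_choose j,
    show (2 : ℚ) ^ (m + 1 + 2 * j) = 2 ^ m * 2 * 4 ^ j by
      rw [pow_add, pow_succ, pow_mul]; norm_num,
    show (-1 : ℚ) ^ (m + 1 + 1) = (-1) ^ m by ring]
  push_cast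
  field_simp
  linear_combination ((2 * j).choose j : ℚ) * (2 * j).choose m * hc

theorem eulerE_add_eulerE_add_one (n : ℕ) (x : ℚ) :
    eulerE n x + eulerE n (x + 1) = 2 * x ^ n := by
  let f : ℚ → ℚ := fun r => r ^ n
  let u : ℕ → ℚ := fun k => (-1 / 2) ^ k * (fwdDiff 1)^[k] f x
  have hE (y : ℚ) : eulerE n y = ∑ k ∈ range (n + 1), (-1 / 2) ^ k * (fwdDiff 1)^[k] f y := by
    refine sum_congr rfl fun k _ => ?_
    rw [fwdDiff_iter_eq_sum_shift, mul_sum, mul_sum]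
    refine sum_congr rfl fun j hj => ?_
    have hj' : j ≤ k := by simpa [Nat.lt_succ_iff] using hj
    have h1 : (-1 : ℚ) ^ k * (-1) ^ (k - j) = (-1) ^ j := by
      rw [← pow_add, show k + (k - j) = j + 2 * (k - j) by omega, pow_add, pow_mul]; simp
    simp only [f, zsmul_eq_mul, nsmul_eq_mul, mul_one]
    push_cast
    rw [div_pow, ← h1]
    ring
  have hu (k : ℕ) : (-1 / 2) ^ k * (fwdDiff 1)^[k] f x + (-1 / 2) ^ k * (fwdDiff 1)^[k] f (x + 1) =
      -2 * (u (k + 1) - u k) := by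
    simp only [u, Function.iterate_succ_apply', fwdDiff, pow_succ]
    ring
  have h0 : u (n + 1) = 0 := by
    simp only [u, f, fwdDiff_iter_pow_eq_zero_of_lt (Nat.lt_succ_self n), Pi.zero_apply, mul_zero]
  rw [hE, hE, ← sum_add_distrib, sum_congr rfl fun k _ => hu k, ← mul_sum, sum_range_sub, h0]
  simp [u, f]

theorem sum_alternating_pow (n N : ℕ) (x : ℚ) :
    ∑ k ∈ range N, (-1) ^ k * (2 * (x + k) ^ n) = eulerE n x - (-1) ^ N * eulerE n (x + N) := by
  induction N with
  | zero => simp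
  | succ N ih =>
    rw [sum_range_succ, ih, ← eulerE_add_eulerE_add_one]
    push_cast
    rw [← add_assoc]
    ring

section Arithmetic

variable (p : ℕ) [Fact p.Prime]

/-- The subring of `p`-integral rational numbers. -/
def pIntegral : Subring ℚ where
  carrier := {x | ¬ p ∣ x.den}
  mul_mem' {x y} hx hy h :=
    ((Fact.out : p.Prime).dvd_mul.1 (h.trans (Rat.mul_den_dvd x y))).elim hx hy
  one_mem' := by simpa using (Fact.out : p.Prime).one_lt.ne'
  add_mem' {x y} hx hy h :=
    ((Fact.out : p.Prime).dvd_mul.1 (h.trans (Rat.add_den_dvd x y))).elim hx hy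
  zero_mem' := by simpa using (Fact.out : p.Prime).one_lt.ne'
  neg_mem' {x} hx := by simpa using hx

/-- Congruence modulo `p` of rational numbers. -/
def PCongr (x y : ℚ) : Prop := ∃ u ∈ pIntegral p, x - y = p * u

variable {p}

theorem one_div_mem_pIntegral {k : ℕ} (hk : ¬ p ∣ k) : (1 / k : ℚ) ∈ pIntegral p := by
  have h0 : k ≠ 0 := fun h => hk (h ▸ dvd_zero p)
  change ¬ p ∣ (1 / k : ℚ).den
  rw [one_div, Rat.inv_natCast_den, if_neg h0]
  exact hk

namespace PCongr

theorem refl (x : ℚ) : PCongr p x x := ⟨0, zero_mem _, by simp⟩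

theorem of_eq {x y : ℚ} (h : x = y) : PCongr p x y := h ▸ refl x

theorem symm {x y : ℚ} : PCongr p x y → PCongr p y x := fun ⟨u, hu, h⟩ =>
  ⟨-u, neg_mem hu, by linear_combination -h⟩

theorem trans {x y z : ℚ} : PCongr p x y → PCongr p y z → PCongr p x z :=
  fun ⟨u, hu, h⟩ ⟨v, hv, h'⟩ => ⟨u + v, add_mem hu hv, by linear_combination h + h'⟩

theorem add {x y z w : ℚ} : PCongr p x y → PCongr p z w → PCongr p (x + z) (y + w) :=
  fun ⟨u, hu, h⟩ ⟨v, hv, h'⟩ => ⟨u + v, add_mem hu hv, by linear_combination h + h'⟩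

theorem mem {x y : ℚ} (hy : y ∈ pIntegral p) : PCongr p x y → x ∈ pIntegral p :=
  fun ⟨u, hu, h⟩ => by
    rw [show x = y + p * u by linear_combination h]
    exact add_mem hy (mul_mem (natCast_mem _ p) hu)

theorem mul {x y z w : ℚ} (hy : y ∈ pIntegral p) (hw : w ∈ pIntegral p) :
    PCongr p x y → PCongr p z w → PCongr p (x * z) (y * w) :=
  fun hxy hzw => by
    have hz := hzw.mem hw
    obtain ⟨u, hu, h⟩ := hxy
    obtain ⟨v, hv, h'⟩ := hzw
    exact ⟨u * z + y * v, add_mem (mul_mem hu hz) (mul_mem hy hv), by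
      linear_combination z * h + y * h'⟩

theorem const_mul {c x y : ℚ} (hc : c ∈ pIntegral p) :
    PCongr p x y → PCongr p (c * x) (c * y) :=
  fun ⟨u, hu, h⟩ => ⟨c * u, mul_mem hc hu, by linear_combination c * h⟩

theorem pow {x y : ℚ} (hy : y ∈ pIntegral p) (h : PCongr p x y) (n : ℕ) :
    PCongr p (x ^ n) (y ^ n) := by
  induction n with
  | zero => exact of_eq (by simp)
  | succ n ih => rw [pow_succ, pow_succ]; exact ih.mul (pow_mem hy n) hy h

theorem sum {ι : Type*} {s : Finset ι} {f g : ι → ℚ} (h : ∀ i ∈ s, PCongr p (f i) (g i)) :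
    PCongr p (∑ i ∈ s, f i) (∑ i ∈ s, g i) := by
  induction s using Finset.cons_induction with
  | empty => exact of_eq (by simp)
  | cons a s ha ih =>
    rw [sum_cons, sum_cons]
    exact (h a (by simp)).add (ih fun i hi => h i (by simp [hi]))

end PCongr

theorem half_mem_pIntegral (hp : 3 < p) : (1 / 2 : ℚ) ∈ pIntegral p := by
  exact_mod_cast one_div_mem_pIntegral (k := 2) (fun h => by have := Nat.le_of_dvd two_pos h; omega)

theorem eulerE_congr (hp : 3 < p) (n : ℕ) {x y : ℚ} (hy : y ∈ pIntegral p) (h : PCongr p x y) :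
    PCongr p (eulerE n x) (eulerE n y) := by
  refine PCongr.sum fun k _ => PCongr.const_mul ?_ (PCongr.sum fun j _ => PCongr.const_mul ?_ ?_)
  · rw [← one_div_pow]; exact pow_mem (half_mem_pIntegral hp) k
  · exact mul_mem (pow_mem (neg_mem (one_mem _)) j) (natCast_mem _ _)
  · exact (h.add (PCongr.refl (j : ℚ))).pow (add_mem hy (natCast_mem _ j)) n

theorem add_prime_congr (x : ℚ) : PCongr p (x + p) x := ⟨1, one_mem _, by ring⟩

theorem eulerE_congr_sum (hp : 3 < p) (n : ℕ) {x : ℚ} (hx : x ∈ pIntegral p) :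
    PCongr p (eulerE n x) (∑ k ∈ range p, (-1) ^ k * (x + k) ^ n) := by
  have hodd : Odd p := (Fact.out : p.Prime).odd_of_ne_two (by omega)
  have h := sum_alternating_pow n p x
  rw [hodd.neg_one_pow] at h
  have h1 := (eulerE_congr hp n hx (add_prime_congr x)).symm
  have h2 := (h1.add (PCongr.refl (eulerE n x))).const_mul (half_mem_pIntegral hp)
  have h3 : ∑ k ∈ range p, (-1) ^ k * (x + k) ^ n =
      1 / 2 * (eulerE n (x + p) + eulerE n x) := by
    rw [show eulerE n (x + p) + eulerE n x = eulerE n x - -1 * eulerE n (x + p) by ring, ← h,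
      mul_sum]
    exact sum_congr rfl fun k _ => by ring
  rw [h3]
  exact (PCongr.of_eq (by ring)).trans h2

theorem eulerE_one_sub_congr (hp : 3 < p) {n : ℕ} (hn : Even n) {x : ℚ} (hx : x ∈ pIntegral p) :
    PCongr p (eulerE n (1 - x)) (eulerE n x) := by
  have hodd : Odd p := (Fact.out : p.Prime).odd_of_ne_two (by omega)
  refine (eulerE_congr_sum hp n (sub_mem (one_mem _) hx)).trans
    (PCongr.trans ?_ (eulerE_congr_sum hp n hx).symm)
  rw [← sum_range_reflect]
  refine PCongr.sum fun k hk => ?_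
  have hk' : k < p := mem_range.1 hk
  have hs : (-1 : ℚ) ^ (p - 1 - k) = (-1) ^ k := by
    have : Even (p - 1) := by obtain ⟨q, rfl⟩ := hodd; simp
    have h1 : (-1 : ℚ) ^ (p - 1 - k) * (-1) ^ k = 1 := by
      rw [← pow_add, show p - 1 - k + k = p - 1 by omega, this.neg_one_pow]
    have h2 : (-1 : ℚ) ^ k * (-1) ^ k = 1 := by rw [← mul_pow]; simp
    exact mul_right_cancel₀ (pow_ne_zero k (by norm_num)) (h1.trans h2.symm)
  rw [hs]
  refine PCongr.const_mul (pow_mem (neg_mem (one_mem _)) k) ?_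
  rw [← hn.neg_pow (x + k)]
  refine PCongr.pow (neg_mem (add_mem hx (natCast_mem _ k))) ⟨1, one_mem _, ?_⟩ n
  push_cast [Nat.cast_sub (by omega : k ≤ p - 1), Nat.cast_sub (by omega : 1 ≤ p)]
  ring

theorem eulerE_zero_congr (hp : 3 < p) {n : ℕ} (hn : Even n) (h0 : n ≠ 0) :
    PCongr p (eulerE n 0) 0 := by
  have h := eulerE_add_eulerE_add_one n 0
  have h1 := eulerE_one_sub_congr hp hn (zero_mem (pIntegral p))
  obtain ⟨u, hu, e⟩ := h1.const_mul (half_mem_pIntegral hp)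
  refine ⟨-u, neg_mem hu, ?_⟩
  rw [zero_pow h0, zero_add] at h
  rw [sub_zero] at e
  linear_combination 1 / 2 * h - e

theorem one_div_sq_congr (hp : 3 < p) {k : ℕ} (hk : ¬ p ∣ k) :
    PCongr p ((1 / k : ℚ) ^ 2) ((k : ℚ) ^ (p - 3)) := by
  have hf : (p : ℤ) ∣ 1 - (k : ℤ) ^ (p - 1) := by
    rw [← ZMod.intCast_zmod_eq_zero_iff_dvd]
    push_cast
    rw [ZMod.pow_card_sub_one_eq_one (by rwa [Ne, ZMod.natCast_eq_zero_iff]), sub_self]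
  obtain ⟨c, hc⟩ := hf
  have hc' : 1 - (k : ℚ) ^ (p - 1) = p * c := by exact_mod_cast hc
  have hk0 : (k : ℚ) ≠ 0 := fun h => hk (by rw [Nat.cast_eq_zero.1 h]; exact dvd_zero p)
  refine ⟨(1 / k : ℚ) ^ 2 * c, mul_mem (pow_mem (one_div_mem_pIntegral hk) 2) (intCast_mem _ c), ?_⟩
  rw [show p - 1 = p - 3 + 2 by omega, pow_add] at hc'
  field_simp
  linear_combination hc'

theorem qProd_congr_one (hp : 3 < p) {k : ℕ} (hk : k < p) :
    PCongr p (qProd (p / 2) k) 1 := by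
  induction k with
  | zero => exact PCongr.of_eq (by simp [qProd])
  | succ k ih =>
    rw [qProd, prod_range_succ, ← qProd]
    refine (one_mul (1 : ℚ)) ▸ (ih (by omega)).mul (one_mem _) (one_mem _) ?_
    have h1 := one_div_mem_pIntegral (p := p) (Nat.not_dvd_of_pos_of_lt k.succ_pos hk)
    refine ⟨-(1 / 2 * (1 / (k.succ : ℕ))), neg_mem (mul_mem (half_mem_pIntegral hp) h1), ?_⟩
    push_cast
    field_simp
    ring

theorem deviation_congr (hp : 3 < p) :
    PCongr p (deviation (p / 2) (p / 4)) ((-1) ^ (p / 4) * eulerE (p - 3) (1 / 4)) := by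
  have hodd : Odd p := (Fact.out : p.Prime).odd_of_ne_two (by omega)
  have hn : Even (p - 3) := by obtain ⟨q, rfl⟩ := hodd; exact ⟨q - 1, by omega⟩
  have h0 : p - 3 ≠ 0 := by omega
  have h4 : (1 / 4 : ℚ) ∈ pIntegral p := by
    have := mul_mem (half_mem_pIntegral hp) (half_mem_pIntegral hp)
    norm_num at this ⊢; exact this
  have step : PCongr p (deviation (p / 2) (p / 4))
      (∑ k ∈ range (p / 4), (-1) ^ (k + 1) * (2 * ((k + 1 : ℕ) : ℚ) ^ (p - 3))) := by
    refine PCongr.sum fun k hk => ?_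
    have hk' : k + 1 < p := by have := mem_range.1 hk; omega
    have hd : ¬ p ∣ k + 1 := Nat.not_dvd_of_pos_of_lt k.succ_pos hk'
    have hs := one_div_sq_congr hp hd
    have hq := (qProd_congr_one hp (by omega : k < p)).pow (one_mem _) 3
    have h2 : PCongr p (2 - (p : ℚ) / 2 / (k + 1)) 2 :=
      ⟨-(1 / 2 * (1 / (k + 1 : ℕ))),
        neg_mem (mul_mem (half_mem_pIntegral hp) (one_div_mem_pIntegral hd)), by
          push_cast; field_simp; ring⟩
    have m2 : (2 : ℚ) ∈ pIntegral p := by exact_mod_cast natCast_mem (pIntegral p) 2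
    have mk : ((k + 1 : ℕ) : ℚ) ^ (p - 3) ∈ pIntegral p := pow_mem (natCast_mem _ _) _
    have := ((hs.mul mk m2 h2).mul (mul_mem mk m2) (pow_mem (one_mem _) 3) hq).const_mul
      (pow_mem (neg_mem (one_mem (pIntegral p))) (k + 1))
    convert this using 1
    · push_cast; ring
    · ring
  refine step.trans ?_
  have hsum := sum_alternating_pow (p - 3) (p / 4 + 1) 0
  rw [sum_range_succ'] at hsum
  simp only [zero_add, Nat.cast_zero, zero_pow h0, mul_zero, add_zero] at hsum
  rw [hsum, pow_succ]
  have hq : PCongr p (eulerE (p - 3) ((p / 4 + 1 : ℕ) : ℚ)) (eulerE (p - 3) (1 / 4)) := by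
    rcases (by obtain ⟨q, hq⟩ := hodd; omega : p = 4 * (p / 4) + 1 ∨ p = 4 * (p / 4) + 3) with h | h
    · have hc : (p : ℚ) = 4 * (p / 4 : ℕ) + 1 := by exact_mod_cast h
      refine PCongr.trans ?_ (eulerE_one_sub_congr hp hn h4)
      refine eulerE_congr hp _ (sub_mem (one_mem _) h4) ⟨1 / 4, h4, ?_⟩
      rw [hc]; push_cast; ring
    · have hc : (p : ℚ) = 4 * (p / 4 : ℕ) + 3 := by exact_mod_cast h
      refine eulerE_congr hp _ h4 ⟨1 / 4, h4, ?_⟩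
      rw [hc]; push_cast; ring
  have := (eulerE_zero_congr hp hn h0).add
    (hq.const_mul (pow_mem (neg_mem (one_mem (pIntegral p))) (p / 4)))
  convert this using 1 <;> ring

theorem dvd_num_of_eq_pow_mul {x u : ℚ} {s : ℕ} (hu : u ∈ pIntegral p) (h : x = p ^ s * u) :
    (p : ℤ) ^ s ∣ x.num := by
  have hu' : ¬ p ∣ u.den := hu
  have e : x.num * u.den = (p : ℤ) ^ s * (u.num * x.den) := by
    have hx := Rat.mul_den_eq_num x
    have hv := Rat.mul_den_eq_num u
    have : (x.num : ℚ) * u.den = (p : ℚ) ^ s * (u.num * x.den) := by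
      rw [← hx, ← hv, h]; ring
    exact_mod_cast this
  have hcop : IsCoprime ((p : ℤ) ^ s) (u.den : ℤ) :=
    (Nat.isCoprime_iff_coprime.2 (((Fact.out : p.Prime).coprime_iff_not_dvd).2 hu')).pow_left
  exact hcop.dvd_of_dvd_mul_right ⟨_, e⟩

theorem legendreSym_two_eq (hp : p ≠ 2) : legendreSym p 2 = (-1) ^ (p / 2 + p / 4) := by
  have hodd : p % 2 = 1 := (Fact.out : p.Prime).mod_two_eq_one_iff_ne_two.2 hp
  rw [legendreSym.at_two hp, ZMod.χ₈_nat_eq_if_mod_eight, if_neg (by omega)]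
  have h4 : p / 4 = 2 * (p / 8) + p % 8 / 4 := by omega
  have h2 : p / 2 = 4 * (p / 8) + p % 8 / 2 := by omega
  split_ifs with h
  · refine (Even.neg_one_pow ?_).symm
    rw [Nat.even_iff]
    rcases h with h | h <;> rw [h] at h2 h4 <;> omega
  · refine (Odd.neg_one_pow ?_).symm
    rw [Nat.odd_iff]
    rcases (by omega : p % 8 = 3 ∨ p % 8 = 5) with h | h <;> rw [h] at h2 h4 <;> omega

end Arithmetic

/-- Lemma 2.7 (Mao): for any prime `p > 3`,
`∑_{k=1}^{(p-1)/2} G((p+1)/2, k) ≡ p(-1|p) + (p³/4)(2|p) E_{p-3}(1/4) (mod p⁴)`. -/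
theorem sum_G_congr (p : ℕ) [Fact (Nat.Prime p)] (hp : 3 < p) :
    ((p : ℤ)) ^ 4 ∣
      ((∑ k ∈ Finset.Icc 1 ((p - 1) / 2), G ((p + 1) / 2) k) -
        ((p : ℚ) * (legendreSym p (-1) : ℚ) +
          (p : ℚ) ^ 3 / 4 * (legendreSym p 2 : ℚ) * eulerE (p - 3) (1 / 4))).num := by
  have hodd : p % 2 = 1 := (Fact.out : p.Prime).mod_two_eq_one_iff_ne_two.2 (by omega)
  have hS := sum_G_eq (p / 2) (by omega)
  have hm : (2 : ℚ) * (p / 2 : ℕ) + 1 = p := by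
    exact_mod_cast (by omega : 2 * (p / 2) + 1 = p)
  have ht : ((p / 2 : ℕ) : ℚ) + 1 / 2 = p / 2 := by linarith
  rw [hm, ht, show p / 2 / 2 = p / 4 by omega] at hS
  rw [show (p - 1) / 2 = p / 2 by omega, show (p + 1) / 2 = p / 2 + 1 by omega, hS,
    legendreSym.at_neg_one (by omega), ZMod.χ₄_eq_neg_one_pow hodd,
    legendreSym_two_eq (by omega)]
  obtain ⟨u, hu, h⟩ := deviation_congr hp
  have h2 := half_mem_pIntegral hp
  refine dvd_num_of_eq_pow_mul
    (mul_mem (mul_mem (pow_mem (neg_mem (one_mem _)) (p / 2)) (mul_mem h2 h2)) hu) ?_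
  push_cast
  rw [pow_add]
  linear_combination (p : ℚ) ^ 3 / 4 * (-1) ^ (p / 2) * h
end
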